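/- arXiv:2402.18260 — 4 statements merged into one kernel-verified Lean document; each statement's English description precedes it below -/
import Mathlib

section
/- Let Z = (Z_1, …, Z_n) be a Gaussian random vector in ℝ^n with mean vector μ ∈ ℝ^n satisfying μ_i > 0 for all i. Let m̃ ∈ ℝ be a median of max_{1≤i≤n} (μ_i − Z_i)/μ_i (i.e. P(max_i (μ_i − Z_i)/μ_i ≤ m̃) ≥ 1/2 and P(max_i (μ_i − Z_i)/μ_i ≥ m̃) ≥ 1/2), and assume m̃ ≤ 1. Let σ̃² = max_{1≤i≤n} Var(Z_i)/μ_i² with σ̃ > 0. Then P( min_{1≤i≤n} Z_i ≤ 0 ) ≤ 1 − Φ( (1 − m̃)/σ̃ ), where Φ is the standard normal cumulative distribution function. -/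
open MeasureTheory ProbabilityTheory
open scoped NNReal ENNReal

/-- `Z` is a Gaussian random vector in `ℝⁿ` with mean vector `μ` and covariance
matrix `S` under `Q`: every linear combination of coordinates is one-dimensional
Gaussian with the corresponding mean and variance. -/
def IsGaussianVector {Ω : Type*} [MeasurableSpace Ω] (Q : Measure Ω) {n : ℕ}
    (Z : Ω → Fin n → ℝ) (μ : Fin n → ℝ) (S : Matrix (Fin n) (Fin n) ℝ) : Prop :=
  (∀ i, Measurable fun ω => Z ω i) ∧
    ∀ a : Fin n → ℝ,
      Measure.map (fun ω => ∑ i, a i * Z ω i) Q =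
        gaussianReal (∑ i, a i * μ i) (∑ i, ∑ j, a i * S i j * a j).toNNReal

open Set Filter Topology

/-- The standard normal density. -/
noncomputable def normalPDF (x : ℝ) : ℝ := gaussianPDFReal 0 1 x

/-- The standard normal cumulative distribution function. -/
noncomputable def normalCDF (x : ℝ) : ℝ := cdf (gaussianReal 0 1) x

/-- The standard normal quantile function, with junk values outside `(0, 1)`. -/
noncomputable def normalQuantile : ℝ → ℝ := Function.invFun normalCDF

/-- The Gaussian isoperimetric profile `φ ∘ Φ⁻¹`. -/
noncomputable def isoProfile (p : ℝ) : ℝ := normalPDF (normalQuantile p)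

theorem normalPDF_eq (x : ℝ) : normalPDF x = (√(2 * Real.pi))⁻¹ * Real.exp (-x ^ 2 / 2) := by
  simp [normalPDF, gaussianPDFReal]

theorem normalPDF_pos (x : ℝ) : 0 < normalPDF x := gaussianPDFReal_pos _ _ _ one_ne_zero

theorem normalPDF_neg (x : ℝ) : normalPDF (-x) = normalPDF x := by simp [normalPDF_eq]

theorem hasDerivAt_normalPDF (x : ℝ) : HasDerivAt normalPDF (-x * normalPDF x) x := by
  have h1 : HasDerivAt (fun y : ℝ => -y ^ 2 / 2) (-x) x := by
    refine (((hasDerivAt_pow 2 x).neg).div_const 2).congr_deriv ?_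
    norm_num
    ring
  have h := (h1.exp).const_mul (√(2 * Real.pi))⁻¹
  have he : normalPDF = fun y => (√(2 * Real.pi))⁻¹ * Real.exp (-y ^ 2 / 2) :=
    funext normalPDF_eq
  rw [he]
  refine h.congr_deriv ?_
  ring

theorem continuous_normalPDF : Continuous normalPDF :=
  continuous_iff_continuousAt.2 fun x => (hasDerivAt_normalPDF x).continuousAt

theorem normalPDF_le_of_sq_le {x y : ℝ} (h : y ^ 2 ≤ x ^ 2) : normalPDF x ≤ normalPDF y := by
  rw [normalPDF_eq, normalPDF_eq]
  gcongr

theorem normalPDF_le_one (x : ℝ) : normalPDF x ≤ 1 := by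
  rw [normalPDF_eq]
  have h1 : (√(2 * Real.pi))⁻¹ ≤ 1 := by
    apply inv_le_one_of_one_le₀
    rw [Real.one_le_sqrt]
    linarith [Real.pi_gt_three]
  have h2 : Real.exp (-x ^ 2 / 2) ≤ 1 := Real.exp_le_one_iff.2 (by nlinarith [sq_nonneg x])
  exact mul_le_one₀ h1 (Real.exp_pos _).le h2

theorem abs_mul_normalPDF_le_one (x : ℝ) : |x * normalPDF x| ≤ 1 := by
  rw [abs_mul, abs_of_pos (normalPDF_pos x), normalPDF_eq]
  have h1 : (√(2 * Real.pi))⁻¹ ≤ 1 := by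
    apply inv_le_one_of_one_le₀
    rw [Real.one_le_sqrt]
    linarith [Real.pi_gt_three]
  have h2 : |x| ≤ Real.exp (x ^ 2 / 2) := by
    have := Real.add_one_le_exp (x ^ 2 / 2)
    nlinarith [sq_nonneg (|x| - 1), sq_abs x]
  have h3 : |x| * Real.exp (-x ^ 2 / 2) ≤ 1 := by
    rw [neg_div, Real.exp_neg, ← div_eq_mul_inv]
    exact div_le_one_of_le₀ h2 (Real.exp_pos _).le
  calc |x| * ((√(2 * Real.pi))⁻¹ * Real.exp (-x ^ 2 / 2))
      = (√(2 * Real.pi))⁻¹ * (|x| * Real.exp (-x ^ 2 / 2)) := by ring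
    _ ≤ 1 := mul_le_one₀ h1 (by positivity) h3

theorem normalCDF_eq_integral (x : ℝ) : normalCDF x = ∫ y in Iic x, normalPDF y := by
  rw [normalCDF, cdf_eq_real, measureReal_def, gaussianReal_apply_eq_integral _ one_ne_zero,
    ENNReal.toReal_ofReal]
  · rfl
  · exact integral_nonneg fun y => gaussianPDFReal_nonneg _ _ _

theorem hasDerivAt_normalCDF (x : ℝ) : HasDerivAt normalCDF (normalPDF x) x := by
  have hint : Integrable normalPDF := integrable_gaussianPDFReal 0 1
  have he : normalCDF = fun y => normalCDF 0 + ∫ z in (0 : ℝ)..y, normalPDF z := by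
    funext y
    rw [normalCDF_eq_integral, normalCDF_eq_integral,
      ← intervalIntegral.integral_Iic_sub_Iic hint.integrableOn hint.integrableOn]
    ring
  rw [he]
  exact (intervalIntegral.integral_hasDerivAt_right (hint.intervalIntegrable)
    (continuous_normalPDF.stronglyMeasurableAtFilter _ _)
    continuous_normalPDF.continuousAt).const_add _

theorem continuous_normalCDF : Continuous normalCDF :=
  continuous_iff_continuousAt.2 fun x => (hasDerivAt_normalCDF x).continuousAt

theorem strictMono_normalCDF : StrictMono normalCDF :=
  strictMono_of_hasDerivAt_pos hasDerivAt_normalCDF normalPDF_pos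

theorem tendsto_normalCDF_atTop : Tendsto normalCDF atTop (𝓝 1) := tendsto_cdf_atTop _

theorem tendsto_normalCDF_atBot : Tendsto normalCDF atBot (𝓝 0) := tendsto_cdf_atBot _

theorem normalCDF_mem_Ioo (x : ℝ) : normalCDF x ∈ Ioo (0 : ℝ) 1 :=
  ⟨(cdf_nonneg _ (x - 1)).trans_lt (strictMono_normalCDF (by linarith)),
    (strictMono_normalCDF (by linarith : x < x + 1)).trans_le (cdf_le_one _ _)⟩

theorem normalCDF_neg (x : ℝ) : normalCDF (-x) = 1 - normalCDF x := by
  have hint : Integrable normalPDF := integrable_gaussianPDFReal 0 1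
  have h1 : normalCDF (-x) = ∫ y in Ioi x, normalPDF y := by
    rw [normalCDF_eq_integral, ← integral_comp_neg_Ioi]
    simp [normalPDF_neg]
  have h2 := integral_add_compl (measurableSet_Iic (a := x)) hint
  have h3 : ∫ y, normalPDF y = 1 := integral_gaussianPDFReal_eq_one 0 one_ne_zero
  rw [compl_Iic, h3, ← normalCDF_eq_integral] at h2
  linarith

theorem normalQuantile_normalCDF (x : ℝ) : normalQuantile (normalCDF x) = x :=
  Function.leftInverse_invFun strictMono_normalCDF.injective x

theorem normalCDF_normalQuantile {p : ℝ} (hp : p ∈ Ioo (0 : ℝ) 1) :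
    normalCDF (normalQuantile p) = p := by
  have h : p ∈ range normalCDF := by
    obtain ⟨a, ha⟩ := (tendsto_normalCDF_atBot.eventually (gt_mem_nhds hp.1)).exists
    obtain ⟨b, hb⟩ := (tendsto_normalCDF_atTop.eventually (lt_mem_nhds hp.2)).exists
    exact mem_range_of_exists_le_of_exists_ge continuous_normalCDF ⟨a, ha.le⟩ ⟨b, hb.le⟩
  exact Function.invFun_eq h

theorem strictMonoOn_normalQuantile : StrictMonoOn normalQuantile (Ioo 0 1) := by
  intro a ha b hb hab
  rw [← strictMono_normalCDF.lt_iff_lt, normalCDF_normalQuantile ha, normalCDF_normalQuantile hb]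
  exact hab

theorem continuousAt_normalQuantile {p : ℝ} (hp : p ∈ Ioo (0 : ℝ) 1) :
    ContinuousAt normalQuantile p := by
  refine strictMonoOn_normalQuantile.continuousAt_of_image_mem_nhds (Ioo_mem_nhds hp.1 hp.2) ?_
  convert univ_mem
  refine eq_univ_of_forall fun x => ⟨normalCDF x, normalCDF_mem_Ioo x, normalQuantile_normalCDF x⟩

theorem normalQuantile_one_sub {p : ℝ} (hp : p ∈ Ioo (0 : ℝ) 1) :
    normalQuantile (1 - p) = -normalQuantile p := by
  conv_lhs => rw [← normalCDF_normalQuantile hp, ← normalCDF_neg, normalQuantile_normalCDF]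

theorem normalQuantile_half : normalQuantile (1 / 2) = 0 := by
  have h := normalQuantile_one_sub (p := 1 / 2) ⟨by norm_num, by norm_num⟩
  norm_num at h ⊢
  linarith

theorem isoProfile_pos (p : ℝ) : 0 < isoProfile p := normalPDF_pos _

theorem isoProfile_normalCDF (x : ℝ) : isoProfile (normalCDF x) = normalPDF x := by
  rw [isoProfile, normalQuantile_normalCDF]

theorem hasDerivAt_normalQuantile {p : ℝ} (hp : p ∈ Ioo (0 : ℝ) 1) :
    HasDerivAt normalQuantile (isoProfile p)⁻¹ p := by
  refine HasDerivAt.of_local_left_inverse (continuousAt_normalQuantile hp)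
    (hasDerivAt_normalCDF _) (isoProfile_pos p).ne' ?_
  filter_upwards [Ioo_mem_nhds hp.1 hp.2] with y hy using normalCDF_normalQuantile hy

theorem hasDerivAt_isoProfile {p : ℝ} (hp : p ∈ Ioo (0 : ℝ) 1) :
    HasDerivAt isoProfile (-normalQuantile p) p := by
  have h := (hasDerivAt_normalPDF (normalQuantile p)).comp p (hasDerivAt_normalQuantile hp)
  refine h.congr_deriv ?_
  change -normalQuantile p * isoProfile p * (isoProfile p)⁻¹ = _
  rw [mul_inv_cancel_right₀ (isoProfile_pos p).ne']

theorem continuousAt_isoProfile {p : ℝ} (hp : p ∈ Ioo (0 : ℝ) 1) : ContinuousAt isoProfile p :=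
  (hasDerivAt_isoProfile hp).continuousAt

theorem isoProfile_one_sub {p : ℝ} (hp : p ∈ Ioo (0 : ℝ) 1) :
    isoProfile (1 - p) = isoProfile p := by
  rw [isoProfile, normalQuantile_one_sub hp, normalPDF_neg, isoProfile]

theorem nonneg_of_hasDerivAt_nonneg {f f' : ℝ → ℝ} {x : ℝ} (hx : 0 ≤ x) (h0 : f 0 = 0)
    (hf : ∀ s ∈ Icc 0 x, HasDerivAt f (f' s) s) (hf' : ∀ s ∈ Icc 0 x, 0 ≤ f' s) : 0 ≤ f x := by
  have hm : MonotoneOn f (Icc 0 x) := by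
    refine monotoneOn_of_deriv_nonneg (convex_Icc 0 x)
      (fun s hs => (hf s hs).continuousAt.continuousWithinAt)
      (fun s hs => (hf s (interior_subset hs)).differentiableAt.differentiableWithinAt) ?_
    intro s hs
    rw [(hf s (interior_subset hs)).deriv]
    exact hf' s (interior_subset hs)
  simpa [h0] using hm (left_mem_Icc.2 hx) (right_mem_Icc.2 hx) hx

theorem hasDerivAt_isoProfile_sq {p : ℝ} (hp : p ∈ Ioo (0 : ℝ) 1) :
    HasDerivAt (fun r => isoProfile r ^ 2) (-2 * (isoProfile p * normalQuantile p)) p := by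
  refine ((hasDerivAt_isoProfile hp).pow 2).congr_deriv ?_
  norm_num
  ring

theorem hasDerivAt_isoProfile_mul_normalQuantile {p : ℝ} (hp : p ∈ Ioo (0 : ℝ) 1) :
    HasDerivAt (fun r => isoProfile r * normalQuantile r) (1 - normalQuantile p ^ 2) p := by
  refine ((hasDerivAt_isoProfile hp).mul (hasDerivAt_normalQuantile hp)).congr_deriv ?_
  rw [mul_inv_cancel₀ (isoProfile_pos p).ne']
  ring

theorem monotone_div_normalPDF : Monotone fun x => x / normalPDF x := by
  refine monotone_of_hasDerivAt_nonneg
    (fun x => (hasDerivAt_id x).div (hasDerivAt_normalPDF x) (normalPDF_pos x).ne') fun x => ?_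
  have := normalPDF_pos x
  simp only [id]
  apply div_nonneg _ (sq_nonneg _)
  nlinarith [mul_nonneg (sq_nonneg x) this.le]

theorem normalQuantile_sq_convex {c x : ℝ} (hx : 0 ≤ x) (h0 : 0 < c - x) (h1 : c + x < 1) :
    2 * normalQuantile c ^ 2 ≤ normalQuantile (c + x) ^ 2 + normalQuantile (c - x) ^ 2 := by
  have key : 0 ≤ normalQuantile (c + x) ^ 2 + normalQuantile (c - x) ^ 2
      - 2 * normalQuantile c ^ 2 := by
    refine nonneg_of_hasDerivAt_nonneg
      (f := fun s => normalQuantile (c + s) ^ 2 + normalQuantile (c - s) ^ 2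
        - 2 * normalQuantile c ^ 2)
      (f' := fun s => 2 * (normalQuantile (c + s) / isoProfile (c + s))
        - 2 * (normalQuantile (c - s) / isoProfile (c - s))) hx (by simp; ring) ?_ ?_
    · rintro s ⟨hs0, hsx⟩
      have hp : c + s ∈ Ioo (0 : ℝ) 1 := ⟨by linarith, by linarith⟩
      have hm : c - s ∈ Ioo (0 : ℝ) 1 := ⟨by linarith, by linarith⟩
      have e1 := ((hasDerivAt_normalQuantile hp).comp_const_add c s).pow 2
      have e2 := ((hasDerivAt_normalQuantile hm).comp_const_sub c s).pow 2
      refine ((e1.add e2).sub_const _).congr_deriv ?_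
      norm_num
      ring
    · rintro s ⟨hs0, hsx⟩
      have hp : c + s ∈ Ioo (0 : ℝ) 1 := ⟨by linarith, by linarith⟩
      have hm : c - s ∈ Ioo (0 : ℝ) 1 := ⟨by linarith, by linarith⟩
      have := monotone_div_normalPDF
        (strictMonoOn_normalQuantile.monotoneOn hm hp (by linarith : c - s ≤ c + s))
      simp only at this
      change 0 ≤ 2 * (normalQuantile (c + s) / normalPDF (normalQuantile (c + s)))
        - 2 * (normalQuantile (c - s) / normalPDF (normalQuantile (c - s)))
      linarith
  linarith

theorem isoProfile_sq_add_ge {c x : ℝ} (hx : 0 ≤ x) (h0 : 0 < c - x) (h1 : c + x < 1) :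
    2 * isoProfile c ^ 2 + 2 * normalQuantile c ^ 2 * x ^ 2 ≤
      isoProfile (c + x) ^ 2 + isoProfile (c - x) ^ 2 + 2 * x ^ 2 := by
  have key : 0 ≤ isoProfile (c + x) ^ 2 + isoProfile (c - x) ^ 2 + 2 * x ^ 2
      - 2 * normalQuantile c ^ 2 * x ^ 2 - 2 * isoProfile c ^ 2 := by
    refine nonneg_of_hasDerivAt_nonneg
      (f := fun s => isoProfile (c + s) ^ 2 + isoProfile (c - s) ^ 2 + 2 * s ^ 2
        - 2 * normalQuantile c ^ 2 * s ^ 2 - 2 * isoProfile c ^ 2)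
      (f' := fun s => -2 * (isoProfile (c + s) * normalQuantile (c + s))
        + 2 * (isoProfile (c - s) * normalQuantile (c - s)) + 4 * s
        - 4 * normalQuantile c ^ 2 * s) hx (by simp; ring) ?_ ?_
    · rintro s ⟨hs0, hsx⟩
      have hp : c + s ∈ Ioo (0 : ℝ) 1 := ⟨by linarith, by linarith⟩
      have hm : c - s ∈ Ioo (0 : ℝ) 1 := ⟨by linarith, by linarith⟩
      have e1 := (hasDerivAt_isoProfile_sq hp).comp_const_add c s
      have e2 := (hasDerivAt_isoProfile_sq hm).comp_const_sub c s
      have e3 := (hasDerivAt_pow 2 s).const_mul 2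
      have e4 := (hasDerivAt_pow 2 s).const_mul (2 * normalQuantile c ^ 2)
      refine ((((e1.add e2).add e3).sub e4).sub_const _).congr_deriv ?_
      norm_num
      ring
    · rintro t ⟨ht0, htx⟩
      refine nonneg_of_hasDerivAt_nonneg
        (f := fun s => -2 * (isoProfile (c + s) * normalQuantile (c + s))
          + 2 * (isoProfile (c - s) * normalQuantile (c - s)) + 4 * s
          - 4 * normalQuantile c ^ 2 * s)
        (f' := fun s => 2 * (normalQuantile (c + s) ^ 2 + normalQuantile (c - s) ^ 2)
          - 4 * normalQuantile c ^ 2) ht0 (by simp) ?_ ?_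
      · rintro s ⟨hs0, hsx⟩
        have hp : c + s ∈ Ioo (0 : ℝ) 1 := ⟨by linarith, by linarith⟩
        have hm : c - s ∈ Ioo (0 : ℝ) 1 := ⟨by linarith, by linarith⟩
        have e1 := ((hasDerivAt_isoProfile_mul_normalQuantile hp).comp_const_add c s).const_mul (-2)
        have e2 := ((hasDerivAt_isoProfile_mul_normalQuantile hm).comp_const_sub c s).const_mul 2
        have e3 := (hasDerivAt_id s).const_mul 4
        have e4 := (hasDerivAt_id s).const_mul (4 * normalQuantile c ^ 2)
        refine (((e1.add e2).add e3).sub e4).congr_deriv ?_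
        ring
      · rintro s ⟨hs0, hsx⟩
        have := normalQuantile_sq_convex (c := c) hs0 (by linarith) (by linarith)
        linarith
  linarith

theorem normalQuantile_sq_le {c x : ℝ} (hx : 0 ≤ x) (h0 : 0 < c - x) (hc : c ≤ 1 / 2) :
    normalQuantile (c + x) ^ 2 ≤ normalQuantile (c - x) ^ 2 := by
  have hm : c - x ∈ Ioo (0 : ℝ) 1 := ⟨by linarith, by linarith⟩
  have hp : c + x ∈ Ioo (0 : ℝ) 1 := ⟨by linarith, by linarith⟩
  have h1 := strictMonoOn_normalQuantile.monotoneOn hm hp (by linarith)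
  have h2 := strictMonoOn_normalQuantile.monotoneOn hp
    (b := 1 - (c - x)) ⟨by linarith [hm.2], by linarith⟩ (by linarith)
  rw [normalQuantile_one_sub hm] at h2
  nlinarith

theorem isoProfile_sq_sub_le {c x : ℝ} (hx : 0 ≤ x) (h0 : 0 < c - x) (hc : c ≤ 1 / 2) :
    isoProfile (c + x) ^ 2 - isoProfile (c - x) ^ 2 ≤
      -4 * (isoProfile c * normalQuantile c) * x := by
  have key : 0 ≤ -4 * (isoProfile c * normalQuantile c) * x
      - isoProfile (c + x) ^ 2 + isoProfile (c - x) ^ 2 := by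
    refine nonneg_of_hasDerivAt_nonneg
      (f := fun s => -4 * (isoProfile c * normalQuantile c) * s
        - isoProfile (c + s) ^ 2 + isoProfile (c - s) ^ 2)
      (f' := fun s => -4 * (isoProfile c * normalQuantile c)
        + 2 * (isoProfile (c + s) * normalQuantile (c + s))
        + 2 * (isoProfile (c - s) * normalQuantile (c - s))) hx (by simp) ?_ ?_
    · rintro s ⟨hs0, hsx⟩
      have hp : c + s ∈ Ioo (0 : ℝ) 1 := ⟨by linarith, by linarith⟩
      have hm : c - s ∈ Ioo (0 : ℝ) 1 := ⟨by linarith, by linarith⟩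
      have e1 := (hasDerivAt_isoProfile_sq hp).comp_const_add c s
      have e2 := (hasDerivAt_isoProfile_sq hm).comp_const_sub c s
      have e3 := (hasDerivAt_id s).const_mul (-4 * (isoProfile c * normalQuantile c))
      refine ((e3.sub e1).add e2).congr_deriv ?_
      ring
    · rintro t ⟨ht0, htx⟩
      refine nonneg_of_hasDerivAt_nonneg
        (f := fun s => -4 * (isoProfile c * normalQuantile c)
          + 2 * (isoProfile (c + s) * normalQuantile (c + s))
          + 2 * (isoProfile (c - s) * normalQuantile (c - s)))
        (f' := fun s => 2 * (normalQuantile (c - s) ^ 2 - normalQuantile (c + s) ^ 2))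
        ht0 (by simp; ring) ?_ ?_
      · rintro s ⟨hs0, hsx⟩
        have hp : c + s ∈ Ioo (0 : ℝ) 1 := ⟨by linarith, by linarith⟩
        have hm : c - s ∈ Ioo (0 : ℝ) 1 := ⟨by linarith, by linarith⟩
        have e1 := ((hasDerivAt_isoProfile_mul_normalQuantile hp).comp_const_add c s).const_mul 2
        have e2 := ((hasDerivAt_isoProfile_mul_normalQuantile hm).comp_const_sub c s).const_mul 2
        refine ((e1.const_add _).add e2).congr_deriv ?_
        ring
      · rintro s ⟨hs0, hsx⟩
        have := normalQuantile_sq_le (c := c) hs0 (by linarith) hc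
        linarith
  linarith

theorem isoProfile_sq_sub_sq_le {c x : ℝ} (hx : 0 ≤ x) (h0 : 0 < c - x) (h1 : c + x < 1) :
    (isoProfile (c + x) ^ 2 - isoProfile (c - x) ^ 2) ^ 2 ≤
      16 * isoProfile c ^ 2 * normalQuantile c ^ 2 * x ^ 2 := by
  wlog hc : c ≤ 1 / 2 generalizing c with H
  · have hm : c - x ∈ Ioo (0 : ℝ) 1 := ⟨by linarith, by linarith⟩
    have hp : c + x ∈ Ioo (0 : ℝ) 1 := ⟨by linarith, by linarith⟩
    have hc' : c ∈ Ioo (0 : ℝ) 1 := ⟨by linarith, by linarith⟩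
    have := H (c := 1 - c) (by linarith) (by linarith) (by linarith)
    rw [show 1 - c + x = 1 - (c - x) by ring, show 1 - c - x = 1 - (c + x) by ring,
      isoProfile_one_sub hm, isoProfile_one_sub hp, isoProfile_one_sub hc',
      normalQuantile_one_sub hc'] at this
    linarith [this]
  · have hle := isoProfile_sq_sub_le hx h0 hc
    have hge : isoProfile (c - x) ≤ isoProfile (c + x) :=
      normalPDF_le_of_sq_le (normalQuantile_sq_le hx h0 hc)
    have hge' : 0 ≤ isoProfile (c + x) ^ 2 - isoProfile (c - x) ^ 2 := by
      have := isoProfile_pos (c - x)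
      nlinarith
    calc _ ≤ (-4 * (isoProfile c * normalQuantile c) * x) ^ 2 := by gcongr
      _ = _ := by ring

/-- Bobkov's two-point inequality. -/
theorem bobkov_two_point {a b : ℝ} (ha : a ∈ Ioo (0 : ℝ) 1) (hb : b ∈ Ioo (0 : ℝ) 1) :
    isoProfile ((a + b) / 2) ≤ (√(isoProfile a ^ 2 + ((a - b) / 2) ^ 2)
      + √(isoProfile b ^ 2 + ((a - b) / 2) ^ 2)) / 2 := by
  wlog hab : b ≤ a generalizing a b with H
  · have := H hb ha (by linarith)
    rw [add_comm b a, show (b - a) / 2 = -((a - b) / 2) by ring, neg_sq] at this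
    linarith
  obtain ⟨c, hc⟩ : ∃ c, c = (a + b) / 2 := ⟨_, rfl⟩
  obtain ⟨x, hx⟩ : ∃ x, x = (a - b) / 2 := ⟨_, rfl⟩
  obtain rfl : a = c + x := by linarith
  obtain rfl : b = c - x := by linarith
  rw [← hc, ← hx]
  have h1 := isoProfile_sq_add_ge (c := c) (x := x) (by linarith) hb.1 ha.2
  have h2 := isoProfile_sq_sub_sq_le (c := c) (x := x) (by linarith) hb.1 ha.2
  have hi := isoProfile_pos c
  set α := √(isoProfile (c + x) ^ 2 + x ^ 2) with hα
  set β := √(isoProfile (c - x) ^ 2 + x ^ 2) with hβ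
  have hα0 : 0 ≤ α := Real.sqrt_nonneg _
  have hβ0 : 0 ≤ β := Real.sqrt_nonneg _
  have hα2 : α ^ 2 = isoProfile (c + x) ^ 2 + x ^ 2 := Real.sq_sqrt (by positivity)
  have hβ2 : β ^ 2 = isoProfile (c - x) ^ 2 + x ^ 2 := Real.sq_sqrt (by positivity)
  set i := isoProfile c
  have h3 : (α ^ 2 - β ^ 2) ^ 2 ≤ 8 * i ^ 2 * (α ^ 2 + β ^ 2 - 2 * i ^ 2) := by
    calc (α ^ 2 - β ^ 2) ^ 2 = (isoProfile (c + x) ^ 2 - isoProfile (c - x) ^ 2) ^ 2 := by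
          rw [hα2, hβ2]; ring
      _ ≤ 8 * i ^ 2 * (2 * normalQuantile c ^ 2 * x ^ 2) := by linarith
      _ ≤ _ := by
          gcongr
          rw [hα2, hβ2]
          linarith
  by_contra! hlt
  have hS : (α + β) ^ 2 < 4 * i ^ 2 := by nlinarith
  have hD : (α - β) ^ 2 < 4 * i ^ 2 := by nlinarith [mul_nonneg hα0 hβ0]
  nlinarith [mul_pos (sub_pos.2 hS) (sub_pos.2 hD)]

/-- The law of `∑ ε_w w`, for `w` ranging over a list of vectors and independent uniform
signs `ε_w`. -/
noncomputable def rademacherSum {E : Type*} [AddCommGroup E] [MeasurableSpace E] :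
    List E → Measure E
  | [] => Measure.dirac 0
  | w :: W => (2⁻¹ : ℝ≥0∞) •
      ((rademacherSum W).map (· + w) + (rademacherSum W).map (· - w))

/-- The squared largest half-increment of `f` at `y` along the steps `± 2 w`. -/
noncomputable def stepOscSq {E : Type*} [AddCommGroup E] (f : E → ℝ) (w y : E) : ℝ :=
  (max |f y - f (y + 2 • w)| |f y - f (y - 2 • w)| / 2) ^ 2

section RademacherSum

variable {E : Type*} [AddCommGroup E] [MeasurableSpace E] [MeasurableAdd E]

theorem map_add_right_eq_equiv (μ : Measure E) (w : E) :
    μ.map (· + w) = μ.map (MeasurableEquiv.addRight w) := rfl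

theorem map_sub_right_eq_equiv (μ : Measure E) (w : E) :
    μ.map (· - w) = μ.map (MeasurableEquiv.addRight (-w)) := by
  simp [sub_eq_add_neg]

instance isProbabilityMeasure_rademacherSum (W : List E) :
    IsProbabilityMeasure (rademacherSum W) := by
  induction W with
  | nil => exact inferInstanceAs (IsProbabilityMeasure (Measure.dirac 0))
  | cons w W ih =>
    constructor
    rw [rademacherSum, map_sub_right_eq_equiv, map_add_right_eq_equiv, Measure.smul_apply,
      Measure.add_apply, MeasurableEquiv.map_apply, MeasurableEquiv.map_apply]
    simp only [preimage_univ, measure_univ, smul_eq_mul]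
    rw [one_add_one_eq_two, ENNReal.inv_mul_cancel two_ne_zero ENNReal.ofNat_ne_top]

variable [MeasurableSingletonClass E] {F : Type*} [NormedAddCommGroup F]

theorem integrable_rademacherSum (W : List E) (f : E → F) : Integrable f (rademacherSum W) := by
  induction W generalizing f with
  | nil => exact integrable_dirac (by simp)
  | cons w W ih =>
    refine Integrable.smul_measure (Integrable.add_measure ?_ ?_) (by simp)
    · rw [map_add_right_eq_equiv, integrable_map_equiv]
      exact ih _
    · rw [map_sub_right_eq_equiv, integrable_map_equiv]
      exact ih _

theorem integral_rademacherSum_cons [NormedSpace ℝ F] (w : E) (W : List E) (f : E → F) :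
    ∫ y, f y ∂rademacherSum (w :: W) =
      (2⁻¹ : ℝ) • (∫ y, f (y + w) ∂rademacherSum W + ∫ y, f (y - w) ∂rademacherSum W) := by
  rw [rademacherSum, integral_smul_measure, integral_add_measure]
  · rw [map_add_right_eq_equiv, map_sub_right_eq_equiv, integral_map_equiv, integral_map_equiv]
    simp [sub_eq_add_neg]
  · rw [map_add_right_eq_equiv, integrable_map_equiv]
    exact integrable_rademacherSum _ _
  · rw [map_sub_right_eq_equiv, integrable_map_equiv]
    exact integrable_rademacherSum _ _

end RademacherSum

theorem sqrt_sq_add_sq_integral_le {α : Type*} [MeasurableSpace α] {μ : Measure α} {A B : α → ℝ}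
    (hA : Integrable A μ) (hB : Integrable B μ) :
    √((∫ x, A x ∂μ) ^ 2 + (∫ x, B x ∂μ) ^ 2) ≤ ∫ x, √(A x ^ 2 + B x ^ 2) ∂μ := by
  have h := norm_integral_le_integral_norm (μ := μ) fun x => (A x : ℂ) + B x * Complex.I
  have e : ∫ x, ((A x : ℂ) + B x * Complex.I) ∂μ =
      ((∫ x, A x ∂μ : ℝ) : ℂ) + ((∫ x, B x ∂μ : ℝ) : ℂ) * Complex.I := by
    rw [integral_add hA.ofReal (hB.ofReal.mul_const _), integral_mul_const,
      integral_complex_ofReal, integral_complex_ofReal]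
  rw [e] at h
  simpa only [Complex.norm_add_mul_I] using h

theorem integral_mem_Ioo {α : Type*} [MeasurableSpace α] {μ : Measure α} [IsProbabilityMeasure μ]
    {f : α → ℝ} (hi : Integrable f μ) (hf : ∀ x, f x ∈ Ioo (0 : ℝ) 1) :
    ∫ x, f x ∂μ ∈ Ioo (0 : ℝ) 1 := by
  have pos : ∀ g : α → ℝ, Integrable g μ → (∀ x, 0 < g x) → 0 < ∫ x, g x ∂μ := by
    intro g hg h0
    rw [integral_pos_iff_support_of_nonneg (fun x => (h0 x).le) hg]
    have : Function.support g = univ := eq_univ_of_forall fun x => (h0 x).ne'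
    simp [this]
  refine ⟨pos f hi fun x => (hf x).1, ?_⟩
  have := pos (fun x => 1 - f x) ((integrable_const 1).sub hi) fun x => sub_pos.2 (hf x).2
  rw [integral_sub (integrable_const 1) hi] at this
  simpa using this

theorem abs_sub_div_two_sq_le_stepOscSq_add {E : Type*} [AddCommGroup E]
    (f : E → ℝ) (w y : E) :
    ((f (y + w) - f (y - w)) / 2) ^ 2 ≤ stepOscSq f w (y + w) := by
  rw [stepOscSq, show y + w - 2 • w = y - w by rw [two_nsmul]; abel, ← sq_abs (_ / 2), abs_div,
    abs_two]
  gcongr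
  exact le_max_right _ _

theorem abs_sub_div_two_sq_le_stepOscSq_sub {E : Type*} [AddCommGroup E]
    (f : E → ℝ) (w y : E) :
    ((f (y + w) - f (y - w)) / 2) ^ 2 ≤ stepOscSq f w (y - w) := by
  rw [stepOscSq, show y - w + 2 • w = y + w by rw [two_nsmul]; abel, ← sq_abs (_ / 2), abs_div,
    abs_two, abs_sub_comm]
  gcongr
  exact le_max_left _ _

/-- Bobkov's inequality on the discrete cube. -/
theorem bobkov_rademacherSum {E : Type*} [AddCommGroup E] [MeasurableSpace E] [MeasurableAdd E]
    [MeasurableSingletonClass E] (W : List E) (f : E → ℝ) (hf : ∀ y, f y ∈ Ioo (0 : ℝ) 1) :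
    isoProfile (∫ y, f y ∂rademacherSum W) ≤
      ∫ y, √(isoProfile (f y) ^ 2 + (W.map fun w => stepOscSq f w y).sum) ∂rademacherSum W := by
  induction W generalizing f with
  | nil =>
    simp [rademacherSum, integral_dirac, Real.sqrt_sq (isoProfile_pos _).le]
  | cons w W ih =>
    rw [integral_rademacherSum_cons, integral_rademacherSum_cons]
    set D := (∫ y, f (y + w) ∂rademacherSum W - ∫ y, f (y - w) ∂rademacherSum W) / 2 with hD
    have hDint : D = ∫ y, (f (y + w) - f (y - w)) / 2 ∂rademacherSum W := by
      rw [integral_div, integral_sub (integrable_rademacherSum _ _) (integrable_rademacherSum _ _)]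
    have half : ∀ τ : E → E, (∀ w' y, stepOscSq (fun z => f (τ z)) w' y = stepOscSq f w' (τ y)) →
        (∀ y, ((f (y + w) - f (y - w)) / 2) ^ 2 ≤ stepOscSq f w (τ y)) →
        √(isoProfile (∫ y, f (τ y) ∂rademacherSum W) ^ 2 + D ^ 2) ≤
          ∫ y, √(isoProfile (f (τ y)) ^ 2 + ((w :: W).map fun w' => stepOscSq f w' (τ y)).sum)
            ∂rademacherSum W := by
      intro τ hτ hw
      have h := ih (fun y => f (τ y)) (fun y => hf _)
      simp only [hτ] at h
      refine (Real.sqrt_le_sqrt (add_le_add_left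
        (pow_le_pow_left₀ (isoProfile_pos _).le h 2) _)).trans ?_
      rw [hDint]
      refine (sqrt_sq_add_sq_integral_le (integrable_rademacherSum _ _)
        (integrable_rademacherSum _ _)).trans ?_
      refine integral_mono (integrable_rademacherSum _ _) (integrable_rademacherSum _ _) fun y => ?_
      apply Real.sqrt_le_sqrt
      rw [Real.sq_sqrt, List.map_cons, List.sum_cons]
      · linarith [hw y]
      · refine add_nonneg (sq_nonneg _) (List.sum_nonneg ?_)
        intro r hr
        obtain ⟨w', -, rfl⟩ := List.mem_map.1 hr
        exact sq_nonneg _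
    have hp := half (· + w) (fun w' y => by
      simp only [stepOscSq, add_right_comm y w, sub_add_eq_add_sub])
      (abs_sub_div_two_sq_le_stepOscSq_add f w)
    have hm := half (· - w) (fun w' y => by
      simp only [stepOscSq, add_sub_right_comm, sub_right_comm y w])
      (abs_sub_div_two_sq_le_stepOscSq_sub f w)
    have h2 := bobkov_two_point
      (integral_mem_Ioo (integrable_rademacherSum W _) fun y => hf (y + w))
      (integral_mem_Ioo (integrable_rademacherSum W _) fun y => hf (y - w))
    rw [smul_eq_mul, smul_eq_mul, inv_mul_eq_div, inv_mul_eq_div]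
    refine h2.trans ?_
    gcongr

theorem charFun_rademacherSum {E : Type*} [NormedAddCommGroup E] [InnerProductSpace ℝ E]
    [MeasurableSpace E] [BorelSpace E] (W : List E) (t : E) :
    charFun (rademacherSum W) t = ((W.map fun w => Real.cos (inner ℝ w t)).prod : ℝ) := by
  induction W with
  | nil => simp [rademacherSum]
  | cons w W ih =>
    rw [charFun_apply] at ih ⊢
    rw [integral_rademacherSum_cons]
    simp only [inner_add_left, inner_sub_left, Complex.ofReal_add, Complex.ofReal_sub, add_mul,
      sub_mul, Complex.exp_add, Complex.exp_sub, div_eq_mul_inv, ← Complex.exp_neg]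
    rw [integral_mul_const, integral_mul_const, ih, List.map_cons, List.prod_cons,
      Complex.ofReal_mul, Complex.ofReal_cos, Complex.cos, Complex.real_smul]
    push_cast
    ring_nf

theorem tendsto_inv_sqrt_natCast : Tendsto (fun N : ℕ => (√(N : ℝ))⁻¹) atTop (𝓝 0) :=
  tendsto_inv_atTop_zero.comp (Real.tendsto_sqrt_atTop.comp tendsto_natCast_atTop_atTop)

theorem tendsto_cos_inv_sqrt_mul_pow (a : ℝ) :
    Tendsto (fun N : ℕ => Real.cos ((√(N : ℝ))⁻¹ * a) ^ N) atTop (𝓝 (Real.exp (-a ^ 2 / 2))) := by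
  have key : Tendsto (fun N : ℕ => (N : ℝ) * (Real.cos ((√(N : ℝ))⁻¹ * a) - 1)) atTop
      (𝓝 (-a ^ 2 / 2)) := by
    have hs : Tendsto (fun x : ℝ => x⁻¹ * Real.sin (x * (a / 2))) (𝓝[≠] 0) (𝓝 (a / 2)) := by
      have h : HasDerivAt (fun x : ℝ => Real.sin (x * (a / 2))) (a / 2) 0 := by
        simpa using ((hasDerivAt_id (0 : ℝ)).mul_const (a / 2)).sin
      simpa using h.tendsto_slope_zero
    have hn : Tendsto (fun N : ℕ => (√(N : ℝ))⁻¹) atTop (𝓝[≠] 0) := by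
      refine tendsto_nhdsWithin_iff.2 ⟨tendsto_inv_sqrt_natCast, ?_⟩
      filter_upwards [eventually_gt_atTop 0] with N hN
      have : (0 : ℝ) < N := by exact_mod_cast hN
      exact (inv_pos.2 (Real.sqrt_pos.2 this)).ne'
    have h := ((hs.comp hn).pow 2).const_mul (-2)
    refine (h.congr fun N => ?_).trans_eq (by ring_nf)
    have hc := Real.cos_sq' ((√(N : ℝ))⁻¹ * (a / 2))
    have hd := Real.cos_two_mul ((√(N : ℝ))⁻¹ * (a / 2))
    rw [show 2 * ((√(N : ℝ))⁻¹ * (a / 2)) = (√(N : ℝ))⁻¹ * a by ring] at hd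
    simp only [Function.comp, inv_inv, mul_pow, Real.sq_sqrt (Nat.cast_nonneg N)]
    rw [hd, hc]
    ring
  simpa using Real.tendsto_one_add_pow_exp_of_tendsto key

/-- The steps of the random walk approximating the Gaussian measure of covariance
`∑ j, v j ⊗ v j`. -/
noncomputable def walkSteps {E : Type*} [NormedAddCommGroup E] [NormedSpace ℝ E] {d : ℕ}
    (v : Fin d → E) (N : ℕ) : List E :=
  (List.replicate N (List.ofFn fun j => (√(N : ℝ))⁻¹ • v j)).flatten

theorem sum_map_walkSteps {E : Type*} [NormedAddCommGroup E] [NormedSpace ℝ E] {d : ℕ}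
    (v : Fin d → E) (N : ℕ) (g : E → ℝ) :
    ((walkSteps v N).map g).sum = ∑ j, N * g ((√(N : ℝ))⁻¹ • v j) := by
  simp [walkSteps, List.map_flatten, List.sum_flatten, List.map_ofFn, List.sum_ofFn,
    Finset.mul_sum]

theorem prod_map_walkSteps {E : Type*} [NormedAddCommGroup E] [NormedSpace ℝ E] {d : ℕ}
    (v : Fin d → E) (N : ℕ) (g : E → ℝ) :
    ((walkSteps v N).map g).prod = ∏ j, g ((√(N : ℝ))⁻¹ • v j) ^ N := by
  simp [walkSteps, List.map_flatten, List.prod_flatten, List.map_ofFn, List.prod_ofFn,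
    Finset.prod_pow]

theorem tendsto_rademacherSum_walkSteps {E : Type*} [NormedAddCommGroup E] [InnerProductSpace ℝ E]
    [FiniteDimensional ℝ E] [MeasurableSpace E] [BorelSpace E] {d : ℕ} (v : Fin d → E)
    (ν : ProbabilityMeasure E)
    (hν : ∀ t, charFun (ν : Measure E) t = Real.exp (-(∑ j, inner ℝ (v j) t ^ 2) / 2)) :
    Tendsto (β := ProbabilityMeasure E)
      (fun N => ⟨rademacherSum (walkSteps v N), inferInstance⟩) atTop (𝓝 ν) := by
  refine ProbabilityMeasure.tendsto_iff_tendsto_charFun.2 fun t => ?_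
  rw [hν]
  simp only [ProbabilityMeasure.coe_mk, charFun_rademacherSum, prod_map_walkSteps,
    real_inner_smul_left]
  refine (Complex.continuous_ofReal.tendsto _).comp ?_
  rw [← Finset.sum_neg_distrib, Finset.sum_div, Real.exp_sum]
  exact tendsto_finsetProd _ fun j _ => tendsto_cos_inv_sqrt_mul_pow _

theorem tendsto_integral_rademacherSum_walkSteps {E : Type*} [NormedAddCommGroup E]
    [InnerProductSpace ℝ E] [FiniteDimensional ℝ E] [MeasurableSpace E] [BorelSpace E] {d : ℕ}
    (v : Fin d → E) (ν : Measure E) [IsProbabilityMeasure ν]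
    (hν : ∀ t, charFun ν t = Real.exp (-(∑ j, inner ℝ (v j) t ^ 2) / 2))
    {f : E → ℝ} (hf : Continuous f) (hb : ∀ y, |f y| ≤ 1) :
    Tendsto (fun N => ∫ y, f y ∂rademacherSum (walkSteps v N)) atTop (𝓝 (∫ y, f y ∂ν)) := by
  have h := tendsto_rademacherSum_walkSteps v ⟨ν, inferInstance⟩ hν
  exact ProbabilityMeasure.tendsto_iff_forall_integral_tendsto.1 h
    (BoundedContinuousFunction.ofNormedAddCommGroup f hf 1 hb)

theorem sqrt_add_le {a b : ℝ} (ha : 0 ≤ a) (hb : 0 ≤ b) : √(a + b) ≤ √a + √b := by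
  refine Real.sqrt_le_iff.2 ⟨by positivity, ?_⟩
  have := mul_nonneg (Real.sqrt_nonneg a) (Real.sqrt_nonneg b)
  nlinarith [Real.sq_sqrt ha, Real.sq_sqrt hb]

/-- Bobkov's inequality for a Gaussian measure, applied to `Φ ∘ k` where `G j` bounds the
derivative of `k` in the direction `v j`. -/
theorem bobkov_gaussian {E : Type*} [NormedAddCommGroup E] [InnerProductSpace ℝ E]
    [FiniteDimensional ℝ E] [MeasurableSpace E] [BorelSpace E] {d : ℕ}
    (v : Fin d → E) (ν : Measure E) [IsProbabilityMeasure ν]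
    (hν : ∀ t, charFun ν t = Real.exp (-(∑ j, inner ℝ (v j) t ^ 2) / 2))
    {k : E → ℝ} (hk : Continuous k) {G : Fin d → E → ℝ} {L C δ : ℝ} (hL : 0 ≤ L) (hC : 0 ≤ C)
    (hδ : 0 < δ) (hG0 : ∀ j y, 0 ≤ G j y) (hG : ∀ y, ∑ j, G j y ^ 2 ≤ L ^ 2)
    (hinc : ∀ y j s, |s| ≤ δ → |normalCDF (k (y + s • v j)) - normalCDF (k y)| ≤
      normalPDF (k y) * G j y * |s| + C * s ^ 2) :
    isoProfile (∫ y, normalCDF (k y) ∂ν) ≤ √(1 + L ^ 2) * ∫ y, normalPDF (k y) ∂ν := by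
  set K : ℝ := ∑ _j : Fin d, (4 * C * L + 4 * C ^ 2) with hK
  have hK0 : 0 ≤ K := by positivity
  have hGL : ∀ j y, G j y ≤ L := fun j y => by
    refine le_of_sq_le_sq ?_ hL
    exact (Finset.single_le_sum (f := fun j => G j y ^ 2) (fun _ _ => sq_nonneg _)
      (Finset.mem_univ j)).trans (hG y)
  have hosc : ∀ N : ℕ, 0 < N → 2 * (√(N : ℝ))⁻¹ ≤ δ → ∀ y,
      √(isoProfile (normalCDF (k y)) ^ 2 +
        ((walkSteps v N).map fun w => stepOscSq (fun z => normalCDF (k z)) w y).sum) ≤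
      √(1 + L ^ 2) * normalPDF (k y) + √(K * (√(N : ℝ))⁻¹) := by
    intro N hN hNδ y
    set r := (√(N : ℝ))⁻¹ with hr
    have hN1 : (1 : ℝ) ≤ N := by exact_mod_cast hN
    have hr0 : 0 < r := by positivity
    have hr1 : r ≤ 1 := inv_le_one_of_one_le₀ (Real.one_le_sqrt.2 hN1)
    have hNr : N * r ^ 2 = 1 := by
      rw [hr, inv_pow, Real.sq_sqrt (by linarith), mul_inv_cancel₀ (by linarith)]
    have hp0 := normalPDF_pos (k y)
    have hp1 := normalPDF_le_one (k y)
    have hstep : ∀ j, N * stepOscSq (fun z => normalCDF (k z)) (r • v j) y ≤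
        normalPDF (k y) ^ 2 * G j y ^ 2 + (4 * C * L + 4 * C ^ 2) * r := by
      intro j
      have hb : stepOscSq (fun z => normalCDF (k z)) (r • v j) y ≤
          (normalPDF (k y) * G j y * r + 2 * C * r ^ 2) ^ 2 := by
        have h1 := hinc y j (2 * r) (by rwa [abs_of_pos (by positivity)])
        have h2 := hinc y j (-(2 * r)) (by rwa [abs_neg, abs_of_pos (by positivity)])
        rw [abs_neg, neg_sq] at h2
        rw [abs_of_pos (by positivity : 0 < 2 * r), abs_sub_comm] at h1 h2
        have e : (2 : ℕ) • r • v j = (2 * r) • v j := by rw [two_nsmul, two_mul, add_smul]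
        rw [neg_smul, ← sub_eq_add_neg] at h2
        rw [stepOscSq, e]
        refine pow_le_pow_left₀ (div_nonneg (le_max_of_le_left (abs_nonneg _)) two_pos.le) ?_ 2
        rw [div_le_iff₀ two_pos]
        exact max_le (by linarith) (by linarith)
      have hpG : normalPDF (k y) * G j y ≤ L := by
        calc _ ≤ 1 * L := mul_le_mul hp1 (hGL j y) (hG0 j y) zero_le_one
          _ = L := one_mul L
      have hCpG : C * (normalPDF (k y) * G j y) ≤ C * L := by gcongr
      calc _ ≤ N * (normalPDF (k y) * G j y * r + 2 * C * r ^ 2) ^ 2 := by gcongr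
        _ = N * r ^ 2 * (normalPDF (k y) * G j y + 2 * C * r) ^ 2 := by ring
        _ = normalPDF (k y) ^ 2 * G j y ^ 2 + 4 * (C * (normalPDF (k y) * G j y)) * r
            + 4 * C ^ 2 * r * r := by rw [hNr]; ring
        _ ≤ normalPDF (k y) ^ 2 * G j y ^ 2 + 4 * (C * L) * r + 4 * C ^ 2 * r * 1 := by gcongr
        _ = _ := by ring
    rw [sum_map_walkSteps, isoProfile_normalCDF]
    have hsum : ∑ j, N * stepOscSq (fun z => normalCDF (k z)) (r • v j) y ≤
        normalPDF (k y) ^ 2 * L ^ 2 + K * r := by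
      refine (Finset.sum_le_sum fun j _ => hstep j).trans ?_
      rw [Finset.sum_add_distrib, ← Finset.mul_sum, ← Finset.sum_mul]
      have := hG y
      gcongr
    refine (Real.sqrt_le_sqrt (add_le_add_right hsum _)).trans ?_
    rw [show normalPDF (k y) ^ 2 + (normalPDF (k y) ^ 2 * L ^ 2 + K * r) =
      (1 + L ^ 2) * normalPDF (k y) ^ 2 + K * r by ring]
    refine (sqrt_add_le (by positivity) (by positivity)).trans ?_
    rw [Real.sqrt_mul (by positivity), Real.sqrt_sq hp0.le]
  have hcdf := tendsto_integral_rademacherSum_walkSteps v ν hν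
    (continuous_normalCDF.comp hk) fun y => by
      rw [Function.comp, abs_of_pos (normalCDF_mem_Ioo _).1]
      exact (normalCDF_mem_Ioo _).2.le
  have hpdf := tendsto_integral_rademacherSum_walkSteps v ν hν
    (continuous_normalPDF.comp hk) fun y => by
      rw [Function.comp, abs_of_pos (normalPDF_pos _)]
      exact normalPDF_le_one _
  have hint : Integrable (fun y => normalCDF (k y)) ν := by
    refine Integrable.of_bound (continuous_normalCDF.comp hk).aestronglyMeasurable 1
      (Eventually.of_forall fun y => ?_)
    rw [Real.norm_eq_abs, abs_of_pos (normalCDF_mem_Ioo _).1]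
    exact (normalCDF_mem_Ioo _).2.le
  have hleft := (continuousAt_isoProfile
    (integral_mem_Ioo hint fun y => normalCDF_mem_Ioo _)).tendsto.comp hcdf
  have hright : Tendsto (fun N : ℕ => √(1 + L ^ 2) *
      (∫ y, normalPDF (k y) ∂rademacherSum (walkSteps v N)) + √(K * (√(N : ℝ))⁻¹)) atTop
      (𝓝 (√(1 + L ^ 2) * (∫ y, normalPDF (k y) ∂ν) + √(K * 0))) :=
    (hpdf.const_mul _).add
      ((Real.continuous_sqrt.tendsto _).comp (tendsto_inv_sqrt_natCast.const_mul K))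
  rw [mul_zero, Real.sqrt_zero, add_zero] at hright
  refine le_of_tendsto_of_tendsto hleft hright ?_
  have hsmall := (tendsto_inv_sqrt_natCast.const_mul 2).eventually
    (ge_mem_nhds (by simpa using hδ : (2 : ℝ) * 0 < δ))
  filter_upwards [hsmall, eventually_gt_atTop 0] with N hN hN0
  refine (bobkov_rademacherSum (walkSteps v N) _ fun y => normalCDF_mem_Ioo (k y)).trans ?_
  refine (integral_mono (integrable_rademacherSum _ _) (integrable_rademacherSum _ _)
    (hosc N hN0 hN)).trans ?_
  rw [integral_add (integrable_rademacherSum _ _) (integrable_rademacherSum _ _),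
    integral_const_mul]
  simp

theorem abs_normalCDF_sub_le (a b : ℝ) :
    |normalCDF b - normalCDF a| ≤ normalPDF a * |b - a| + (b - a) ^ 2 := by
  have hlip : ∀ x, normalPDF x ≤ normalPDF a + |x - a| := fun x => by
    have h := Convex.norm_image_sub_le_of_norm_hasDerivWithin_le (s := univ) (C := 1)
      (fun x _ => (hasDerivAt_normalPDF x).hasDerivWithinAt)
      (fun x _ => by
        rw [neg_mul, norm_neg]
        exact abs_mul_normalPDF_le_one x) convex_univ (mem_univ a) (mem_univ x)
    rw [one_mul, Real.norm_eq_abs, Real.norm_eq_abs] at h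
    linarith [le_abs_self (normalPDF x - normalPDF a)]
  have h := Convex.norm_image_sub_le_of_norm_hasDerivWithin_le (s := uIcc a b)
    (C := normalPDF a + |b - a|)
    (fun x _ => (hasDerivAt_normalCDF x).hasDerivWithinAt)
    (fun x hx => by
      rw [Real.norm_eq_abs, abs_of_pos (normalPDF_pos x)]
      exact (hlip x).trans (add_le_add_right (abs_sub_left_of_mem_uIcc hx) _))
    (convex_uIcc a b) left_mem_uIcc right_mem_uIcc
  rw [Real.norm_eq_abs, Real.norm_eq_abs] at h
  rw [← sq_abs (b - a)]
  linarith

/-- The smooth approximation `β⁻¹ log ∑ exp (β yᵢ)` of `max yᵢ`. -/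
noncomputable def softMax {n : ℕ} (β : ℝ) (y : EuclideanSpace ℝ (Fin n)) : ℝ :=
  β⁻¹ * Real.log (∑ i, Real.exp (β * y i))

/-- The gradient of `softMax`. -/
noncomputable def softWeight {n : ℕ} (β : ℝ) (y : EuclideanSpace ℝ (Fin n)) (i : Fin n) : ℝ :=
  Real.exp (β * y i) / ∑ j, Real.exp (β * y j)

section SoftMax

variable {n : ℕ} [NeZero n] {β : ℝ}

theorem sum_exp_pos (β : ℝ) (y : EuclideanSpace ℝ (Fin n)) : 0 < ∑ i, Real.exp (β * y i) :=
  Finset.sum_pos (fun _ _ => Real.exp_pos _) Finset.univ_nonempty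

theorem continuous_softMax (β : ℝ) : Continuous (softMax (n := n) β) := by
  refine continuous_const.mul (Continuous.log ?_ fun y => (sum_exp_pos β y).ne')
  fun_prop

theorem softWeight_nonneg (β : ℝ) (y : EuclideanSpace ℝ (Fin n)) (i : Fin n) :
    0 ≤ softWeight β y i := div_nonneg (Real.exp_pos _).le (sum_exp_pos β y).le

theorem sum_softWeight (β : ℝ) (y : EuclideanSpace ℝ (Fin n)) : ∑ i, softWeight β y i = 1 := by
  simp only [softWeight]
  rw [← Finset.sum_div, div_self (sum_exp_pos β y).ne']

theorem le_softMax (hβ : 0 < β) (y : EuclideanSpace ℝ (Fin n)) (i : Fin n) :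
    y i ≤ softMax β y := by
  rw [softMax, inv_mul_eq_div, le_div_iff₀ hβ, Real.le_log_iff_exp_le (sum_exp_pos β y), mul_comm]
  exact Finset.single_le_sum (f := fun i => Real.exp (β * y i)) (fun _ _ => (Real.exp_pos _).le)
    (Finset.mem_univ i)

theorem softMax_le (hβ : 0 < β) {y : EuclideanSpace ℝ (Fin n)} {a : ℝ} (h : ∀ i, y i ≤ a) :
    softMax β y ≤ a + Real.log n / β := by
  have hn : (0 : ℝ) < n := by exact_mod_cast NeZero.pos n
  have hs : ∑ i, Real.exp (β * y i) ≤ n * Real.exp (β * a) := by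
    calc _ ≤ ∑ _i : Fin n, Real.exp (β * a) := by
          gcongr with i
          exact h i
      _ = _ := by simp
  rw [softMax, inv_mul_eq_div, div_le_iff₀ hβ, add_mul, div_mul_cancel₀ _ hβ.ne']
  refine (Real.log_le_log (sum_exp_pos β y) hs).trans_eq ?_
  rw [Real.log_mul hn.ne' (Real.exp_pos _).ne', Real.log_exp]
  ring

theorem softMax_add_sub (y h : EuclideanSpace ℝ (Fin n)) :
    softMax β (y + h) - softMax β y =
      β⁻¹ * Real.log (∑ i, softWeight β y i * Real.exp (β * h i)) := by
  have hpos := sum_exp_pos β y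
  have e : ∑ i, softWeight β y i * Real.exp (β * h i) =
      (∑ i, Real.exp (β * (y + h) i)) / ∑ i, Real.exp (β * y i) := by
    rw [Finset.sum_div]
    refine Finset.sum_congr rfl fun i _ => ?_
    rw [softWeight, PiLp.add_apply, mul_add, Real.exp_add]
    ring
  rw [e, Real.log_div (sum_exp_pos β (y + h)).ne' hpos.ne', softMax, softMax]
  ring

theorem abs_softMax_add_sub_le (hβ : 0 < β) (y h : EuclideanSpace ℝ (Fin n)) {s : ℝ}
    (hsβ : β * s ≤ 1) (hh : ∀ i, |h i| ≤ s) :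
    |softMax β (y + h) - softMax β y| ≤ |∑ i, softWeight β y i * h i| + β * s ^ 2 := by
  have hw := softWeight_nonneg β y
  have hw1 := sum_softWeight β y
  have hlow : Real.exp (β * ∑ i, softWeight β y i * h i) ≤
      ∑ i, softWeight β y i * Real.exp (β * h i) := by
    have := convexOn_exp.map_sum_le (t := Finset.univ) (w := softWeight β y)
      (p := fun i => β * h i) (fun i _ => hw i) hw1 (fun _ _ => mem_univ _)
    simp only [smul_eq_mul] at this
    refine le_of_eq_of_le ?_ this
    rw [Finset.mul_sum]
    congr 1
    exact Finset.sum_congr rfl fun i _ => by ring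
  have hup : ∑ i, softWeight β y i * Real.exp (β * h i) ≤
      β * (∑ i, softWeight β y i * h i) + β ^ 2 * s ^ 2 + 1 := by
    have hi : ∀ i, softWeight β y i * Real.exp (β * h i) ≤
        β * (softWeight β y i * h i) + softWeight β y i * (β ^ 2 * s ^ 2 + 1) := by
      intro i
      have hb : |β * h i| ≤ 1 := by
        rw [abs_mul, abs_of_pos hβ]
        exact (mul_le_mul_of_nonneg_left (hh i) hβ.le).trans hsβ
      have he := (abs_le.1 (Real.abs_exp_sub_one_sub_id_le hb)).2
      have hsq : (β * h i) ^ 2 ≤ β ^ 2 * s ^ 2 := by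
        rw [mul_pow, ← sq_abs (h i)]
        have := hh i
        gcongr
      calc _ ≤ softWeight β y i * (1 + β * h i + β ^ 2 * s ^ 2) :=
            mul_le_mul_of_nonneg_left (by linarith) (hw i)
        _ = _ := by ring
    refine (Finset.sum_le_sum fun i _ => hi i).trans_eq ?_
    rw [Finset.sum_add_distrib, ← Finset.mul_sum, ← Finset.sum_mul, hw1]
    ring
  have hpos := (Real.exp_pos _).trans_le hlow
  have h1 : β * ∑ i, softWeight β y i * h i ≤
      Real.log (∑ i, softWeight β y i * Real.exp (β * h i)) :=
    (Real.le_log_iff_exp_le hpos).2 hlow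
  have h2 : Real.log (∑ i, softWeight β y i * Real.exp (β * h i)) ≤
      β * (∑ i, softWeight β y i * h i) + β ^ 2 * s ^ 2 := by
    linarith [Real.log_le_sub_one_of_pos hpos]
  rw [softMax_add_sub, inv_mul_eq_div]
  have hq : 0 ≤ β * s ^ 2 := by positivity
  rw [abs_le]
  constructor
  · rw [le_div_iff₀ hβ]
    nlinarith [neg_abs_le (∑ i, softWeight β y i * h i), mul_nonneg hβ.le hq]
  · rw [div_le_iff₀ hβ]
    nlinarith [le_abs_self (∑ i, softWeight β y i * h i)]

theorem sum_sq_sum_softWeight_le {d : ℕ} {v : Fin d → EuclideanSpace ℝ (Fin n)}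
    (hv : ∀ i, ∑ j, v j i ^ 2 ≤ 1) (y : EuclideanSpace ℝ (Fin n)) :
    ∑ j, (∑ i, softWeight β y i * v j i) ^ 2 ≤ 1 := by
  calc _ ≤ ∑ j, ∑ i, softWeight β y i * v j i ^ 2 :=
        Finset.sum_le_sum fun j _ => by
          simpa using (even_two.convexOn_pow (𝕜 := ℝ)).map_sum_le (t := Finset.univ)
            (w := softWeight β y) (p := fun i => v j i)
            (fun i _ => softWeight_nonneg β y i) (sum_softWeight β y) (fun _ _ => mem_univ _)
    _ = ∑ i, softWeight β y i * ∑ j, v j i ^ 2 := by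
        rw [Finset.sum_comm]
        simp only [Finset.mul_sum]
    _ ≤ ∑ i, softWeight β y i * 1 :=
        Finset.sum_le_sum fun i _ => mul_le_mul_of_nonneg_left (hv i) (softWeight_nonneg β y i)
    _ = 1 := by simpa using sum_softWeight β y

variable {d : ℕ} {v : Fin d → EuclideanSpace ℝ (Fin n)} {ν : Measure (EuclideanSpace ℝ (Fin n))}
  [IsProbabilityMeasure ν]

theorem bobkov_softMax
    (hν : ∀ t, charFun ν t = Real.exp (-(∑ j, inner ℝ (v j) t ^ 2) / 2))
    (hv : ∀ i, ∑ j, v j i ^ 2 ≤ 1) (hβ : 0 < β) {L : ℝ} (hL : 0 ≤ L) (s : ℝ) :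
    isoProfile (∫ y, normalCDF (L * (s - softMax β y)) ∂ν) ≤
      √(1 + L ^ 2) * ∫ y, normalPDF (L * (s - softMax β y)) ∂ν := by
  refine bobkov_gaussian v ν hν (k := fun y => L * (s - softMax β y))
    (G := fun j y => L * |∑ i, softWeight β y i * v j i|) (C := L * β + 4 * L ^ 2) (δ := β⁻¹)
    (continuous_const.mul (continuous_const.sub (continuous_softMax β))) hL (by positivity)
    (by positivity) (fun j y => by positivity) ?_ ?_
  · intro y
    simp only [mul_pow, sq_abs]
    rw [← Finset.mul_sum]
    exact mul_le_of_le_one_right (sq_nonneg L) (sum_sq_sum_softWeight_le hv y)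
  · intro y j r hr
    have hvj : ∀ i, |v j i| ≤ 1 := fun i => by
      rw [← sq_le_one_iff_abs_le_one]
      exact (Finset.single_le_sum (f := fun j => v j i ^ 2) (fun _ _ => sq_nonneg _)
        (Finset.mem_univ j)).trans (hv i)
    have hβr : β * |r| ≤ 1 := by
      rwa [← le_div_iff₀' hβ, one_div]
    have hinc := abs_softMax_add_sub_le hβ y (r • v j) hβr fun i => by
      rw [PiLp.smul_apply, smul_eq_mul, abs_mul]
      exact mul_le_of_le_one_right (abs_nonneg r) (hvj i)
    set w := ∑ i, softWeight β y i * v j i with hw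
    have hsum : ∑ i, softWeight β y i * (r • v j) i = r * w := by
      rw [hw, Finset.mul_sum]
      refine Finset.sum_congr rfl fun i _ => ?_
      rw [PiLp.smul_apply, smul_eq_mul]
      ring
    have hw1 : |w| ≤ 1 := by
      rw [← sq_le_one_iff_abs_le_one]
      exact (Finset.single_le_sum (f := fun j => (∑ i, softWeight β y i * v j i) ^ 2)
        (fun _ _ => sq_nonneg _) (Finset.mem_univ j)).trans (sum_sq_sum_softWeight_le hv y)
    rw [hsum, abs_mul] at hinc
    have hdiff : |L * (s - softMax β (y + r • v j)) - L * (s - softMax β y)| ≤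
        L * (|r| * |w| + β * |r| ^ 2) := by
      rw [← mul_sub, abs_mul, abs_of_nonneg hL, sub_sub_sub_cancel_left, abs_sub_comm]
      gcongr
    have hdiff2 : |L * (s - softMax β (y + r • v j)) - L * (s - softMax β y)| ≤
        2 * L * |r| := by
      refine hdiff.trans ?_
      have h1 : |r| * |w| ≤ |r| := mul_le_of_le_one_right (abs_nonneg r) hw1
      have h2 : β * |r| ^ 2 ≤ |r| := by
        nlinarith [abs_nonneg r]
      nlinarith
    have hp0 := normalPDF_pos (L * (s - softMax β y))
    have hp1 := normalPDF_le_one (L * (s - softMax β y))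
    refine (abs_normalCDF_sub_le _ _).trans ?_
    have hsq : (L * (s - softMax β (y + r • v j)) - L * (s - softMax β y)) ^ 2 ≤
        (2 * L * |r|) ^ 2 := by
      rw [← sq_abs]
      gcongr
    have hfirst : normalPDF (L * (s - softMax β y)) *
        |L * (s - softMax β (y + r • v j)) - L * (s - softMax β y)| ≤
        normalPDF (L * (s - softMax β y)) * (L * |w|) * |r| + L * β * r ^ 2 := by
      refine (mul_le_mul_of_nonneg_left hdiff hp0.le).trans ?_
      have : normalPDF (L * (s - softMax β y)) * (L * β * r ^ 2) ≤ 1 * (L * β * r ^ 2) := by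
        gcongr
      rw [sq_abs]
      linarith
    rw [mul_pow, mul_pow, sq_abs] at hsq
    linarith

theorem abs_normalCDF_le_one (x : ℝ) : ‖normalCDF x‖ ≤ 1 := by
  rw [Real.norm_eq_abs, abs_of_pos (normalCDF_mem_Ioo _).1]
  exact (normalCDF_mem_Ioo _).2.le

theorem integrable_normalCDF_softMax (L β s : ℝ) :
    Integrable (fun y => normalCDF (L * (s - softMax β y))) ν :=
  Integrable.of_bound (continuous_normalCDF.comp (continuous_const.mul
    (continuous_const.sub (continuous_softMax β)))).aestronglyMeasurable 1
    (Eventually.of_forall fun _ => abs_normalCDF_le_one _)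

theorem hasDerivAt_integral_normalCDF_softMax {L : ℝ} (hL : 0 ≤ L) (β s : ℝ) :
    HasDerivAt (fun s => ∫ y, normalCDF (L * (s - softMax β y)) ∂ν)
      (L * ∫ y, normalPDF (L * (s - softMax β y)) ∂ν) s := by
  have hc : ∀ r, Continuous fun y : EuclideanSpace ℝ (Fin n) => L * (r - softMax β y) :=
    fun r => continuous_const.mul (continuous_const.sub (continuous_softMax β))
  rw [← integral_const_mul]
  refine (hasDerivAt_integral_of_dominated_loc_of_deriv_le (μ := ν) (s := univ)
    (F := fun s y => normalCDF (L * (s - softMax β y)))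
    (F' := fun s y => L * normalPDF (L * (s - softMax β y)))
    (bound := fun _ => L) univ_mem ?_ ?_ ?_ ?_ ?_ ?_).2
  · exact Eventually.of_forall fun r => (continuous_normalCDF.comp (hc r)).aestronglyMeasurable
  · exact integrable_normalCDF_softMax L β s
  · exact (continuous_const.mul (continuous_normalPDF.comp (hc s))).aestronglyMeasurable
  · refine Eventually.of_forall fun y r _ => ?_
    rw [norm_mul, Real.norm_eq_abs, Real.norm_eq_abs, abs_of_nonneg hL,
      abs_of_pos (normalPDF_pos _)]
    exact mul_le_of_le_one_right hL (normalPDF_le_one _)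
  · exact integrable_const L
  · refine Eventually.of_forall fun y r _ => ?_
    have h := (hasDerivAt_normalCDF (L * (r - softMax β y))).comp r
      (((hasDerivAt_id r).sub_const (softMax β y)).const_mul L)
    refine h.congr_deriv ?_
    ring

/-- Shifting the threshold `s` moves the normal quantile of a smoothed probability
`ν (max y ≤ s)` by at least a definite amount. -/
theorem normalQuantile_integral_softMax_add_le
    (hν : ∀ t, charFun ν t = Real.exp (-(∑ j, inner ℝ (v j) t ^ 2) / 2))
    (hv : ∀ i, ∑ j, v j i ^ 2 ≤ 1) (hβ : 0 < β) {L : ℝ} (hL : 0 ≤ L) {a b : ℝ} (hab : a ≤ b) :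
    normalQuantile (∫ y, normalCDF (L * (a - softMax β y)) ∂ν) + L / √(1 + L ^ 2) * (b - a) ≤
      normalQuantile (∫ y, normalCDF (L * (b - softMax β y)) ∂ν) := by
  have hmem : ∀ s, ∫ y, normalCDF (L * (s - softMax β y)) ∂ν ∈ Ioo (0 : ℝ) 1 := fun s =>
    integral_mem_Ioo (integrable_normalCDF_softMax L β s) fun y => normalCDF_mem_Ioo _
  have hmono : Monotone fun s => normalQuantile (∫ y, normalCDF (L * (s - softMax β y)) ∂ν)
      - L / √(1 + L ^ 2) * s := by
    refine monotone_of_hasDerivAt_nonneg (fun s =>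
      ((hasDerivAt_normalQuantile (hmem s)).comp s
        (hasDerivAt_integral_normalCDF_softMax hL β s)).sub
        ((hasDerivAt_id s).const_mul (L / √(1 + L ^ 2)))) fun s => ?_
    have hB := bobkov_softMax hν hv hβ hL s
    have hI := isoProfile_pos (∫ y, normalCDF (L * (s - softMax β y)) ∂ν)
    have hr : 0 < √(1 + L ^ 2) := by positivity
    simp only [Pi.zero_apply, mul_one]
    rw [sub_nonneg, div_le_iff₀ hr, inv_mul_eq_div, div_mul_eq_mul_div, le_div_iff₀ hI]
    nlinarith [mul_le_mul_of_nonneg_left hB hL]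
  have := hmono hab
  simp only at this
  linarith

end SoftMax

section Limit

variable {n : ℕ}

theorem measurableSet_forall_apply_le (a : ℝ) :
    MeasurableSet {y : EuclideanSpace ℝ (Fin n) | ∀ i, y i ≤ a} := by
  rw [ofPred_forall]
  exact MeasurableSet.iInter fun i => measurableSet_le (by fun_prop) measurable_const

theorem measurableSet_forall_apply_lt (b : ℝ) :
    MeasurableSet {y : EuclideanSpace ℝ (Fin n) | ∀ i, y i < b} := by
  rw [ofPred_forall]
  exact MeasurableSet.iInter fun i => measurableSet_lt (by fun_prop) measurable_const

variable [NeZero n] {ν : Measure (EuclideanSpace ℝ (Fin n))} [IsProbabilityMeasure ν]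

theorem mul_measureReal_le_integral_normalCDF_softMax {L β s a : ℝ} (hL : 0 ≤ L) (hβ : 0 < β) :
    normalCDF (L * (s - (a + Real.log n / β))) * ν.real {y | ∀ i, y i ≤ a} ≤
      ∫ y, normalCDF (L * (s - softMax β y)) ∂ν := by
  have hA := measurableSet_forall_apply_le (n := n) a
  rw [mul_comm, ← smul_eq_mul, ← setIntegral_const]
  calc ∫ _ in {y | ∀ i, y i ≤ a}, normalCDF (L * (s - (a + Real.log n / β))) ∂ν
      ≤ ∫ y in {y | ∀ i, y i ≤ a}, normalCDF (L * (s - softMax β y)) ∂ν := by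
        refine setIntegral_mono_on (integrable_const _).integrableOn
          (integrable_normalCDF_softMax L β s).integrableOn hA fun y hy => ?_
        refine strictMono_normalCDF.monotone (mul_le_mul_of_nonneg_left ?_ hL)
        exact sub_le_sub_left (softMax_le hβ hy) s
    _ ≤ _ := setIntegral_le_integral (integrable_normalCDF_softMax L β s)
        (Eventually.of_forall fun y => (normalCDF_mem_Ioo _).1.le)

theorem integral_normalCDF_softMax_le {L β s b : ℝ} (hL : 0 ≤ L) (hβ : 0 < β) :
    ∫ y, normalCDF (L * (s - softMax β y)) ∂ν ≤
      ν.real {y | ∀ i, y i < b} + normalCDF (L * (s - b)) := by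
  have hB := measurableSet_forall_apply_lt (n := n) b
  have hint : Integrable ({y | ∀ i, y i < b}.indicator (1 : EuclideanSpace ℝ (Fin n) → ℝ)) ν :=
    (integrable_const 1).indicator hB
  calc ∫ y, normalCDF (L * (s - softMax β y)) ∂ν
      ≤ ∫ y, ({y | ∀ i, y i < b}.indicator 1 y + normalCDF (L * (s - b))) ∂ν := by
        refine integral_mono (integrable_normalCDF_softMax L β s)
          (hint.add (integrable_const _)) fun y => ?_
        by_cases hy : y ∈ {y : EuclideanSpace ℝ (Fin n) | ∀ i, y i < b}
        · simp only [indicator_of_mem hy, Pi.one_apply]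
          linarith [(normalCDF_mem_Ioo (L * (s - softMax β y))).2,
            (normalCDF_mem_Ioo (L * (s - b))).1]
        · simp only [indicator_of_notMem hy, zero_add]
          rw [mem_ofPred_eq] at hy
          push Not at hy
          obtain ⟨i, hi⟩ := hy
          refine strictMono_normalCDF.monotone (mul_le_mul_of_nonneg_left ?_ hL)
          exact sub_le_sub_left (hi.trans (le_softMax hβ y i)) s
    _ = _ := by
        rw [integral_add hint (integrable_const _), integral_indicator_one hB, integral_const,
          probReal_univ, one_smul]

/-- A Gaussian isoperimetric estimate for maxima: if the maximum of a centred Gaussian vector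
with variances at most one is at most `a` with probability at least one half, then it is less
than `b` with probability at least `normalCDF (b - a)`. -/
theorem normalCDF_sub_le_measureReal {d : ℕ} {v : Fin d → EuclideanSpace ℝ (Fin n)}
    (hν : ∀ t, charFun ν t = Real.exp (-(∑ j, inner ℝ (v j) t ^ 2) / 2))
    (hv : ∀ i, ∑ j, v j i ^ 2 ≤ 1) {a b : ℝ} (hab : a < b)
    (ha : 1 / 2 ≤ ν.real {y | ∀ i, y i ≤ a}) :
    normalCDF (b - a) ≤ ν.real {y | ∀ i, y i < b} := by
  have hN : Tendsto (fun N : ℕ => (N : ℝ)) atTop atTop := tendsto_natCast_atTop_atTop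
  set c : ℕ → ℝ := fun N => normalCDF (N - Real.log n) * (1 / 2) with hc
  set r : ℕ → ℝ := fun N => (N : ℝ) ^ 2 / √(1 + ((N : ℝ) ^ 2) ^ 2) with hr
  have hclim : Tendsto c atTop (𝓝 (1 / 2)) := by
    have h := (tendsto_normalCDF_atTop.comp
      (tendsto_atTop_add_const_right _ (-Real.log n) hN)).mul_const (1 / 2)
    simpa only [one_mul, Function.comp_def, ← sub_eq_add_neg] using h
  have hrlim : Tendsto r atTop (𝓝 1) := by
    have h0 : Tendsto (fun N : ℕ => ((N : ℝ) ^ 2)⁻¹) atTop (𝓝 0) :=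
      ((tendsto_pow_atTop two_ne_zero).comp hN).inv_tendsto_atTop
    have h1 : Tendsto (fun N : ℕ => (√(1 + ((N : ℝ) ^ 2)⁻¹ ^ 2))⁻¹) atTop (𝓝 1) := by
      have h : ContinuousAt (fun x : ℝ => (√(1 + x ^ 2))⁻¹) 0 :=
        ContinuousAt.inv₀ (by fun_prop) (by simp)
      have := h.tendsto.comp h0
      simpa only [Function.comp_def, ne_eq, OfNat.ofNat_ne_zero, not_false_eq_true, zero_pow,
        add_zero, Real.sqrt_one, inv_one] using this
    refine h1.congr' ?_
    filter_upwards [eventually_gt_atTop 0] with N hN0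
    have hp : (0 : ℝ) < (N : ℝ) ^ 2 := by positivity
    rw [hr]
    simp only
    rw [show 1 + ((N : ℝ) ^ 2)⁻¹ ^ 2 = (1 + ((N : ℝ) ^ 2) ^ 2) / ((N : ℝ) ^ 2) ^ 2 by
      field_simp; ring, Real.sqrt_div' _ (by positivity), Real.sqrt_sq hp.le, inv_div]
  have hlim : Tendsto (fun N : ℕ => normalCDF (normalQuantile (c N) + r N * (b - a - 2 / N)))
      atTop (𝓝 (normalCDF (b - a))) := by
    have hq : Tendsto (fun N => normalQuantile (c N)) atTop (𝓝 0) := by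
      have h := (continuousAt_normalQuantile
        (p := 1 / 2) ⟨by norm_num, by norm_num⟩).tendsto.comp hclim
      rwa [normalQuantile_half] at h
    have h2 : Tendsto (fun N : ℕ => b - a - 2 / (N : ℝ)) atTop (𝓝 (b - a - 0)) :=
      tendsto_const_nhds.sub (tendsto_const_nhds.div_atTop hN)
    have h := (continuous_normalCDF.tendsto _).comp (hq.add (hrlim.mul h2))
    simpa only [Function.comp_def, zero_add, one_mul, sub_zero] using h
  have hlim' : Tendsto (fun N : ℕ => ν.real {y | ∀ i, y i < b} + normalCDF (-N))
      atTop (𝓝 (ν.real {y | ∀ i, y i < b})) := by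
    have h := tendsto_const_nhds (x := ν.real {y | ∀ i, y i < b}) |>.add
      (tendsto_normalCDF_atBot.comp (tendsto_neg_atTop_atBot.comp hN))
    simpa using h
  refine le_of_tendsto_of_tendsto hlim hlim' ?_
  have hev : ∀ᶠ N : ℕ in atTop, 2 / (N : ℝ) < b - a :=
    (tendsto_const_nhds.div_atTop hN).eventually_lt_const (sub_pos.2 hab)
  filter_upwards [eventually_gt_atTop 0, hev] with N hN0 hNab
  have hp : (0 : ℝ) < N := by exact_mod_cast hN0
  have hβ : (0 : ℝ) < (N : ℝ) ^ 2 := by positivity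
  have hmem : ∀ s, ∫ y, normalCDF ((N : ℝ) ^ 2 * (s - softMax ((N : ℝ) ^ 2) y)) ∂ν ∈
      Ioo (0 : ℝ) 1 := fun s =>
    integral_mem_Ioo (integrable_normalCDF_softMax _ _ s) fun y => normalCDF_mem_Ioo _
  have hlow : c N ≤
      ∫ y, normalCDF ((N : ℝ) ^ 2 * (a + 1 / N - softMax ((N : ℝ) ^ 2) y)) ∂ν := by
    refine le_trans ?_ (mul_measureReal_le_integral_normalCDF_softMax (a := a) hβ.le hβ)
    rw [show (N : ℝ) ^ 2 * (a + 1 / N - (a + Real.log n / (N : ℝ) ^ 2)) = N - Real.log n by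
      field_simp; ring]
    exact mul_le_mul_of_nonneg_left ha (normalCDF_mem_Ioo _).1.le
  have hup := integral_normalCDF_softMax_le (ν := ν) (s := b - 1 / N) (b := b) hβ.le hβ
  rw [show (N : ℝ) ^ 2 * (b - 1 / N - b) = -N by field_simp; ring] at hup
  refine le_trans ?_ hup
  have hmain := normalQuantile_integral_softMax_add_le hν hv hβ hβ.le
    (a := a + 1 / N) (b := b - 1 / N) (by
      have : 2 / (N : ℝ) = 1 / N + 1 / N := by ring
      linarith)
  have hcmem : c N ∈ Ioo (0 : ℝ) 1 :=
    ⟨mul_pos (normalCDF_mem_Ioo _).1 (by norm_num), hlow.trans_lt (hmem _).2⟩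
  have hqc := strictMonoOn_normalQuantile.monotoneOn hcmem (hmem _) hlow
  rw [← normalCDF_normalQuantile (hmem (b - 1 / N))]
  refine strictMono_normalCDF.monotone ?_
  calc _ ≤ _ := add_le_add_left hqc _
    _ = _ := by rw [show b - a - 2 / (N : ℝ) = b - 1 / N - (a + 1 / N) by ring]
    _ ≤ _ := hmain

end Limit

section CenteredGaussian

variable {Ω : Type*} [MeasurableSpace Ω] {Q : Measure Ω} {n : ℕ} {W : Ω → Fin n → ℝ}

theorem variance_sum_mul (hW : ∀ i, MemLp (fun ω => W ω i) 2 Q) [IsFiniteMeasure Q]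
    (t : Fin n → ℝ) :
    variance (fun ω => ∑ i, t i * W ω i) Q =
      ∑ i, ∑ j, t i * covariance (fun ω => W ω i) (fun ω => W ω j) Q * t j := by
  have hm : ∀ i, MemLp (fun ω => t i * W ω i) 2 Q := fun i => (hW i).const_mul (t i)
  rw [← covariance_self (memLp_finsetSum _ fun i _ => hm i).aemeasurable,
    covariance_fun_sum_fun_sum (X := fun i ω => t i * W ω i) (Y := fun i ω => t i * W ω i) hm hm]
  refine Finset.sum_congr rfl fun i _ => Finset.sum_congr rfl fun j _ => ?_
  rw [covariance_const_mul_left, covariance_const_mul_right]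
  ring

/-- The covariance form of a square-integrable vector is a sum of squares. -/
theorem exists_variance_sum_mul_eq_sum_sq (hW : ∀ i, MemLp (fun ω => W ω i) 2 Q)
    [IsFiniteMeasure Q] :
    ∃ (d : ℕ) (v : Fin d → EuclideanSpace ℝ (Fin n)), ∀ t : EuclideanSpace ℝ (Fin n),
      variance (fun ω => ∑ i, t i * W ω i) Q = ∑ j, inner ℝ (v j) t ^ 2 := by
  set C : Matrix (Fin n) (Fin n) ℝ :=
    Matrix.of fun i j => covariance (fun ω => W ω i) (fun ω => W ω j) Q with hC
  have hquad : ∀ t : Fin n → ℝ,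
      t ⬝ᵥ (C.mulVec t) = variance (fun ω => ∑ i, t i * W ω i) Q := fun t => by
    rw [variance_sum_mul hW t]
    simp [dotProduct, Matrix.mulVec, hC, Finset.mul_sum, mul_assoc]
  have hpos : C.PosSemidef := by
    refine Matrix.PosSemidef.of_dotProduct_mulVec_nonneg ?_ fun t => ?_
    · ext i j
      simp [hC, covariance_comm]
    · rw [star_trivial, hquad]
      exact variance_nonneg _ _
  obtain ⟨d, v, hv⟩ := Matrix.posSemidef_iff_eq_sum_vecMulVec.1 hpos
  refine ⟨d, fun j => WithLp.toLp 2 (v j), fun t => ?_⟩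
  rw [← hquad, hv, Matrix.sum_mulVec, dotProduct_sum]
  refine Finset.sum_congr rfl fun j _ => ?_
  rw [star_trivial, Matrix.vecMulVec_mulVec, dotProduct_smul]
  simp [PiLp.inner_apply, dotProduct, sq, mul_comm]

/-- Isoperimetric estimate for the maximum of a centred Gaussian vector `W`. -/
theorem normalCDF_sub_le_measureReal_forall_lt [NeZero n] [IsProbabilityMeasure Q]
    (hm : ∀ i, Measurable fun ω => W ω i)
    (hW : ∀ t : Fin n → ℝ, ∃ w : ℝ≥0, Q.map (fun ω => ∑ i, t i * W ω i) = gaussianReal 0 w)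
    (hvar : ∀ i, variance (fun ω => W ω i) Q ≤ 1) {a b : ℝ} (hab : a < b)
    (ha : 1 / 2 ≤ Q.real {ω | ∀ i, W ω i ≤ a}) :
    normalCDF (b - a) ≤ Q.real {ω | ∀ i, W ω i < b} := by
  have hsum : ∀ t : Fin n → ℝ, Measurable fun ω => ∑ i, t i * W ω i := fun t =>
    Finset.measurable_sum _ fun i _ => (hm i).const_mul (t i)
  have hL2 : ∀ i, MemLp (fun ω => W ω i) 2 Q := fun i => by
    obtain ⟨w, hw⟩ := hW (Pi.single i 1)
    simp only [Pi.single_apply, ite_mul, one_mul, zero_mul, Finset.sum_ite_eq',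
      Finset.mem_univ, if_true] at hw
    have h := memLp_id_gaussianReal (μ := 0) (v := w) 2
    rw [← hw] at h
    exact h.comp_of_map (hm i).aemeasurable
  obtain ⟨d, v, hv⟩ := exists_variance_sum_mul_eq_sum_sq hL2
  have hmeas : Measurable fun ω => WithLp.toLp 2 (W ω) :=
    (WithLp.measurable_toLp 2 _).comp (measurable_pi_iff.2 hm)
  have := Measure.isProbabilityMeasure_map (μ := Q) hmeas.aemeasurable
  have hA := map_measureReal_apply (μ := Q) hmeas (measurableSet_forall_apply_le a)
  have hB := map_measureReal_apply (μ := Q) hmeas (measurableSet_forall_apply_lt b)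
  refine (normalCDF_sub_le_measureReal (v := v) (fun t => ?_) (fun i => ?_) hab
    (ha.trans_eq hA.symm)).trans_eq hB
  · obtain ⟨w, hw⟩ := hW t
    have hwv : (w : ℝ) = ∑ j, inner ℝ (v j) t ^ 2 := by
      rw [← hv t, ← variance_id_gaussianReal (μ := 0) (v := w), ← hw,
        variance_id_map (hsum t).aemeasurable]
    have hc := charFun_gaussianReal (μ := 0) (v := w) 1
    rw [← hw, charFun_apply_real, integral_map (hsum t).aemeasurable (by fun_prop)] at hc
    rw [charFun_apply, integral_map hmeas.aemeasurable (by fun_prop), ← hwv]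
    convert hc using 1
    · simp [PiLp.inner_apply, mul_comm]
    · push_cast
      congr 1
      ring
  · refine le_trans (le_of_eq ?_) (hvar i)
    have h := hv (EuclideanSpace.single i 1)
    simp only [EuclideanSpace.inner_single_right] at h
    simpa using h.symm

end CenteredGaussian

section GaussianVector

variable {Ω : Type*} [MeasurableSpace Ω] {Q : Measure Ω} {n : ℕ} {Z : Ω → Fin n → ℝ}
  {μ : Fin n → ℝ} {S : Matrix (Fin n) (Fin n) ℝ}

theorem gaussianReal_singleton_of_ne {m x : ℝ} (v : ℝ≥0) (h : m ≠ x) :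
    gaussianReal m v {x} = 0 := by
  rcases eq_or_ne v 0 with rfl | hv
  · simp [gaussianReal_zero_var, h]
  · have := nullSingletonClass_gaussianReal (μ := m) hv
    exact measure_singleton x

/-- A coordinate with nonzero mean of a Gaussian vector almost surely does not vanish. -/
theorem IsGaussianVector.ae_apply_ne_zero (hZ : IsGaussianVector Q Z μ S) (hμ : ∀ i, μ i ≠ 0) :
    ∀ᵐ ω ∂Q, ∀ i, Z ω i ≠ 0 := by
  rw [ae_all_iff]
  intro i
  have h := hZ.2 (Pi.single i 1)
  simp only [Pi.single_apply, ite_mul, one_mul, zero_mul, Finset.sum_ite_eq',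
    Finset.mem_univ, if_true] at h
  have h0 : Q.map (fun ω => Z ω i) {0} = 0 := by
    rw [h, gaussianReal_singleton_of_ne _ (hμ i)]
  rw [Measure.map_apply (hZ.1 i) (measurableSet_singleton 0)] at h0
  simp only [ae_iff, ne_eq, not_not]
  exact h0

/-- Affine recentring of the coordinates of a Gaussian vector. -/
theorem IsGaussianVector.exists_map_sum_sub_mul (hZ : IsGaussianVector Q Z μ S)
    (c t : Fin n → ℝ) :
    ∃ w : ℝ≥0, Q.map (fun ω => ∑ i, t i * ((μ i - Z ω i) * c i)) = gaussianReal 0 w := by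
  set a : Fin n → ℝ := fun i => -(t i * c i) with ha
  have hm : Measurable fun ω => ∑ i, a i * Z ω i :=
    Finset.measurable_sum _ fun i _ => (hZ.1 i).const_mul (a i)
  refine ⟨(∑ i, ∑ j, a i * S i j * a j).toNNReal, ?_⟩
  have h := gaussianReal_map_const_add (μ := ∑ i, a i * μ i)
    (v := (∑ i, ∑ j, a i * S i j * a j).toNNReal) (-∑ i, a i * μ i)
  rw [← hZ.2 a, Measure.map_map (by fun_prop) hm, add_neg_cancel] at h
  rw [← h]
  congr 1
  ext ω
  simp only [Function.comp_apply, ← Finset.sum_neg_distrib, ← Finset.sum_add_distrib, ha]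
  exact Finset.sum_congr rfl fun i _ => by ring

end GaussianVector

/-- Theorem 4 (analytical Borell-TIS safety bound): if `Z` is a Gaussian vector
with mean `μ > 0` (componentwise), `mtil ≤ 1` is a median of
`maxᵢ (μᵢ − Zᵢ)/μᵢ`, and `σtil² = maxᵢ Var(Zᵢ)/μᵢ²` with `σtil > 0`, then
`P(minᵢ Zᵢ ≤ 0) ≤ 1 − Φ((1 − mtil)/σtil)`. -/
theorem analytical_safety_bound {Ω : Type*} [MeasurableSpace Ω] (Q : Measure Ω)
    [IsProbabilityMeasure Q] {n : ℕ} [NeZero n]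
    (Z : Ω → Fin n → ℝ) (μ : Fin n → ℝ) (S : Matrix (Fin n) (Fin n) ℝ)
    (hμ : ∀ i, 0 < μ i) (hZ : IsGaussianVector Q Z μ S)
    (mtil : ℝ) (hmtil : mtil ≤ 1)
    (hmed1 : (1 : ℝ≥0∞) / 2 ≤
      Q {ω | Finset.univ.sup' Finset.univ_nonempty
        (fun i => (μ i - Z ω i) / μ i) ≤ mtil})
    (hmed2 : (1 : ℝ≥0∞) / 2 ≤
      Q {ω | mtil ≤ Finset.univ.sup' Finset.univ_nonempty
        (fun i => (μ i - Z ω i) / μ i)})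
    (σtil : ℝ) (hσtil : 0 < σtil)
    (hσtil2 : σtil ^ 2 = Finset.univ.sup' Finset.univ_nonempty
      fun i => variance (fun ω => Z ω i) Q / (μ i) ^ 2) :
    (Q {ω | Finset.univ.inf' Finset.univ_nonempty (fun i => Z ω i) ≤ 0}).toReal
      ≤ 1 - cdf (gaussianReal 0 1) ((1 - mtil) / σtil) := by
  have hY : ∀ ω i, (μ i - Z ω i) * (μ i * σtil)⁻¹ = (μ i - Z ω i) / μ i / σtil := fun ω i => by
    rw [div_div, div_eq_mul_inv]
  have hle : {ω | Finset.univ.sup' Finset.univ_nonempty (fun i => (μ i - Z ω i) / μ i) ≤ mtil} =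
      {ω | ∀ i, (μ i - Z ω i) * (μ i * σtil)⁻¹ ≤ mtil / σtil} := by
    ext ω
    simp only [mem_ofPred_eq, Finset.sup'_le_iff, Finset.mem_univ, true_imp_iff, hY,
      div_le_div_iff_of_pos_right hσtil]
  have hmed : 1 / 2 ≤ Q.real {ω | ∀ i, (μ i - Z ω i) * (μ i * σtil)⁻¹ ≤ mtil / σtil} := by
    rw [← hle]
    simpa [measureReal_def] using ENNReal.toReal_mono (measure_ne_top _ _) hmed1
  have hlt : {ω | Finset.univ.inf' Finset.univ_nonempty (fun i => Z ω i) ≤ 0} =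
      {ω | ∀ i, (μ i - Z ω i) * (μ i * σtil)⁻¹ < 1 / σtil}ᶜ := by
    ext ω
    have h : ∀ i, (μ i - Z ω i) * (μ i * σtil)⁻¹ < 1 / σtil ↔ 0 < Z ω i := fun i => by
      rw [hY, div_lt_div_iff_of_pos_right hσtil, div_lt_one (hμ i), sub_lt_self_iff]
    simp only [mem_compl_iff, mem_ofPred_eq, Finset.inf'_le_iff, Finset.mem_univ, true_and, h,
      not_forall, not_lt]
  have hYm : ∀ i, Measurable fun ω => (μ i - Z ω i) * (μ i * σtil)⁻¹ := fun i =>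
    ((hZ.1 i).const_sub (μ i)).mul_const _
  have hBm : MeasurableSet {ω | ∀ i, (μ i - Z ω i) * (μ i * σtil)⁻¹ < 1 / σtil} := by
    rw [ofPred_forall]
    exact MeasurableSet.iInter fun i => measurableSet_lt (hYm i) measurable_const
  suffices h : normalCDF ((1 - mtil) / σtil) ≤
      Q.real {ω | ∀ i, (μ i - Z ω i) * (μ i * σtil)⁻¹ < 1 / σtil} by
    rw [hlt, ← measureReal_def, probReal_compl_eq_one_sub hBm]
    exact sub_le_sub_left h 1
  rcases hmtil.lt_or_eq with hlt1 | rfl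
  · rw [sub_div]
    refine normalCDF_sub_le_measureReal_forall_lt hYm
      (hZ.exists_map_sum_sub_mul fun i => (μ i * σtil)⁻¹) (fun i => ?_)
      (div_lt_div_of_pos_right hlt1 hσtil) hmed
    have hv : variance (fun ω => Z ω i) Q / μ i ^ 2 ≤ σtil ^ 2 := by
      rw [hσtil2]
      exact Finset.le_sup' (fun i => variance (fun ω => Z ω i) Q / μ i ^ 2) (Finset.mem_univ i)
    rw [variance_mul_const, variance_const_sub (hZ.1 i).aestronglyMeasurable, inv_pow, mul_pow,
      ← div_eq_mul_inv, ← div_div]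
    exact div_le_one_of_le₀ hv (sq_nonneg _)
  · have h0 : normalCDF 0 = 1 / 2 := by
      have := normalCDF_neg 0
      rw [neg_zero] at this
      linarith
    rw [sub_self, zero_div, h0]
    refine hmed.trans (ENNReal.toReal_mono (measure_ne_top _ _) (measure_mono_ae ?_))
    filter_upwards [hZ.ae_apply_ne_zero fun i => (hμ i).ne'] with ω hω hall i
    refine (hall i).lt_of_ne fun h => hω i ?_
    rw [hY, div_left_inj' hσtil.ne', div_eq_one_iff_eq (hμ i).ne'] at h
    linarith
end

section
/- Let α ∈ (0,1), ε ∈ (0,1), σ̃ > 0 and m̃ ∈ ℝ with m̃ ≤ 1, and set P† = 1 − Φ((1 − m̃)/σ̃), where Φ is the standard normal cumulative distribution function. On a probability space (Ω, Q), let (q_r)_{r≥1} be real-valued random variables (empirical upper quantiles) such that for every r, Q( m̃ > q_r ) ≤ 6ε/(π²r²). If P† ≥ α, then Q( ∃ r ∈ ℕ, 1 − Φ((1 − q_r)/σ̃) < α ) ≤ ε. -/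
open MeasureTheory ProbabilityTheory Real
open scoped NNReal ENNReal

/-- Theorem 5, first part (adaptive Borell method): with `P† = 1 − Φ((1 − m̃)/σ̃) ≥ α`
and empirical upper quantiles `q_r` covering `m̃` from above with probability at least
`1 − 6ε/(π²r²)`, the sequential test falsely declares safety with probability at most `ε`. -/
theorem adaptive_borell_safe {Ω : Type*} [MeasurableSpace Ω] (Q : Measure Ω)
    [IsProbabilityMeasure Q] (α ε σtil mtil : ℝ)
    (hα : α ∈ Set.Ioo (0 : ℝ) 1) (hε : ε ∈ Set.Ioo (0 : ℝ) 1)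
    (hσ : 0 < σtil) (hm : mtil ≤ 1)
    (q : ℕ → Ω → ℝ) (hqmeas : ∀ r, Measurable (q r))
    (hq : ∀ r : ℕ, 1 ≤ r →
      Q {ω | q r ω < mtil} ≤ ENNReal.ofReal (6 * ε / (π ^ 2 * (r : ℝ) ^ 2)))
    (hP : α ≤ 1 - cdf (gaussianReal 0 1) ((1 - mtil) / σtil)) :
    Q {ω | ∃ r : ℕ, 1 ≤ r ∧ 1 - cdf (gaussianReal 0 1) ((1 - q r ω) / σtil) < α}
      ≤ ENNReal.ofReal ε := by
  have hsub : {ω | ∃ r : ℕ, 1 ≤ r ∧ 1 - cdf (gaussianReal 0 1) ((1 - q r ω) / σtil) < α}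
      ⊆ ⋃ r : ℕ, {ω | 1 ≤ r ∧ q r ω < mtil} := by
    rintro ω ⟨r, hr, h⟩
    refine Set.mem_iUnion.2 ⟨r, hr, ?_⟩
    by_contra! hge
    have hmono : cdf (gaussianReal 0 1) ((1 - q r ω) / σtil)
        ≤ cdf (gaussianReal 0 1) ((1 - mtil) / σtil) :=
      monotone_cdf _ (by gcongr)
    linarith
  have hbound (r : ℕ) : Q {ω | 1 ≤ r ∧ q r ω < mtil}
      ≤ ENNReal.ofReal (6 * ε / (π ^ 2 * (r : ℝ) ^ 2)) := by
    by_cases hr : 1 ≤ r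
    · simpa [hr] using hq r hr
    · simp [hr]
  have hsum : HasSum (fun r : ℕ => 6 * ε / (π ^ 2 * (r : ℝ) ^ 2)) ε := by
    have h := hasSum_zeta_two.mul_left (6 * ε / π ^ 2)
    have hε_eq : 6 * ε / π ^ 2 * (π ^ 2 / 6) = ε := by field_simp
    simpa only [hε_eq, div_mul_div_comm, mul_one] using h
  have hnonneg (r : ℕ) : 0 ≤ 6 * ε / (π ^ 2 * (r : ℝ) ^ 2) := by
    have := hε.1
    positivity
  calc _ ≤ Q (⋃ r : ℕ, {ω | 1 ≤ r ∧ q r ω < mtil}) := measure_mono hsub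
    _ ≤ ∑' r : ℕ, Q {ω | 1 ≤ r ∧ q r ω < mtil} := measure_iUnion_le _
    _ ≤ ∑' r : ℕ, ENNReal.ofReal (6 * ε / (π ^ 2 * (r : ℝ) ^ 2)) := ENNReal.tsum_le_tsum hbound
    _ = ENNReal.ofReal ε := by
      rw [← ENNReal.ofReal_tsum_of_nonneg hnonneg hsum.summable, hsum.tsum_eq]
end

section
/- Let α ∈ (0,1), ε ∈ (0,1), σ̃ > 0 and m̃ ∈ ℝ with m̃ ≤ 1, and set P† = 1 − Φ((1 − m̃)/σ̃), where Φ is the standard normal cumulative distribution function. On a probability space (Ω, Q), let (q_r)_{r≥1} be real-valued random variables (empirical lower quantiles) such that for every r, Q( m̃ < q_r ) ≤ 6ε/(π²r²). If P† ≤ α, then Q( ∃ r ∈ ℕ, 1 − Φ((1 − q_r)/σ̃) > α ) ≤ ε. -/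
open MeasureTheory ProbabilityTheory Real
open scoped NNReal ENNReal

/-- Theorem 5, second part (adaptive Borell method): with `P† = 1 − Φ((1 − m̃)/σ̃) ≤ α`
and empirical lower quantiles `q_r` covering `m̃` from below with probability at least
`1 − 6ε/(π²r²)`, the sequential test falsely declares unsafety with probability at most `ε`. -/
theorem adaptive_borell_unsafe {Ω : Type*} [MeasurableSpace Ω] (Q : Measure Ω)
    [IsProbabilityMeasure Q] (α ε σtil mtil : ℝ)
    (hα : α ∈ Set.Ioo (0 : ℝ) 1) (hε : ε ∈ Set.Ioo (0 : ℝ) 1)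
    (hσ : 0 < σtil) (hm : mtil ≤ 1)
    (q : ℕ → Ω → ℝ) (hqmeas : ∀ r, Measurable (q r))
    (hq : ∀ r : ℕ, 1 ≤ r →
      Q {ω | mtil < q r ω} ≤ ENNReal.ofReal (6 * ε / (π ^ 2 * (r : ℝ) ^ 2)))
    (hP : 1 - cdf (gaussianReal 0 1) ((1 - mtil) / σtil) ≤ α) :
    Q {ω | ∃ r : ℕ, 1 ≤ r ∧ α < 1 - cdf (gaussianReal 0 1) ((1 - q r ω) / σtil)}
      ≤ ENNReal.ofReal ε := by
  have hsum : HasSum (fun r : ℕ => 6 * ε / (π ^ 2 * (r : ℝ) ^ 2)) ε := by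
    convert! hasSum_zeta_two.mul_left (6 * ε / π ^ 2) using 1
    · funext r
      rw [div_mul_div_comm, mul_one]
    · field_simp
  have hnonneg : ∀ r : ℕ, 0 ≤ 6 * ε / (π ^ 2 * (r : ℝ) ^ 2) := fun r =>
    div_nonneg (mul_nonneg (by norm_num) hε.1.le) (by positivity)
  have hsub : {ω | ∃ r : ℕ, 1 ≤ r ∧ α < 1 - cdf (gaussianReal 0 1) ((1 - q r ω) / σtil)}
      ⊆ ⋃ r : ℕ, {ω | 1 ≤ r ∧ mtil < q r ω} := by
    rintro ω ⟨r, hr, hω⟩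
    refine Set.mem_iUnion.2 ⟨r, hr, ?_⟩
    by_contra! hle
    have hmono : cdf (gaussianReal 0 1) ((1 - mtil) / σtil)
        ≤ cdf (gaussianReal 0 1) ((1 - q r ω) / σtil) :=
      monotone_cdf _ (by gcongr)
    linarith
  calc _ ≤ Q (⋃ r : ℕ, {ω | 1 ≤ r ∧ mtil < q r ω}) := measure_mono hsub
    _ ≤ ∑' r : ℕ, Q {ω | 1 ≤ r ∧ mtil < q r ω} := measure_iUnion_le _
    _ ≤ ∑' r : ℕ, ENNReal.ofReal (6 * ε / (π ^ 2 * (r : ℝ) ^ 2)) := by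
      refine ENNReal.tsum_le_tsum fun r => ?_
      by_cases hr : 1 ≤ r
      · simpa only [hr, true_and] using hq r hr
      · simp [hr]
    _ = ENNReal.ofReal ε := by
      rw [← ENNReal.ofReal_tsum_of_nonneg hnonneg hsum.summable, hsum.tsum_eq]
end

section
/- Let 0 < α ≤ 1/2, ε ∈ (0,1), σ̃ > 0, m̃ ∈ ℝ with m̃ ≤ 1, and p ∈ [0,1]. Assume p ≥ α and 1 − Φ((1 − m̃)/σ̃) ≥ α. Let (M_r)_{r≥1} be a strictly increasing sequence of positive integers, and on a probability space (Ω, Q) let (Y_r)_{r≥1} be random variables whose laws are Binomial(M_r, p), and let (q_r)_{r≥1} be real-valued random variables with Q( m̃ > q_r ) ≤ 3ε/(π²r²) for every r. With c_r = sqrt((2/M_r)·|log(3ε/(π²r²))|), the probability Q( ∃ r ∈ ℕ, min( 1 − Φ((1 − q_r)/σ̃), Y_r/M_r + sqrt(α(1−α))·c_r ) < α ) is at most ε. -/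
open MeasureTheory ProbabilityTheory Real
open scoped NNReal ENNReal

/-- `Y` has the binomial distribution with `M` trials and success probability `p`
under the probability measure `Q`. -/
def IsBinomial {Ω : Type*} [MeasurableSpace Ω] (Q : Measure Ω) (Y : Ω → ℕ)
    (M : ℕ) (p : ℝ) : Prop :=
  Measurable Y ∧ (∀ ω, Y ω ≤ M) ∧
    ∀ k : ℕ, Q {ω | Y ω = k} = ENNReal.ofReal ((M.choose k : ℝ) * p ^ k * (1 - p) ^ (M - k))

theorem one_sub_exp_neg_le_half_mul {t : ℝ} (ht : 0 ≤ t) :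
    1 - exp (-t) ≤ t * (1 + exp (-t)) / 2 := by
  have hd : ∀ x : ℝ, HasDerivAt (fun x : ℝ => x * (1 + exp (-x)) / 2 + exp (-x))
      ((1 * (1 + exp (-x)) + x * (exp (-x) * (-1))) / 2 + exp (-x) * (-1)) x := by
    intro x
    have he : HasDerivAt (fun x : ℝ => exp (-x)) (exp (-x) * (-1)) x :=
      (hasDerivAt_neg x).exp
    exact (((hasDerivAt_id' x).mul (he.const_add 1)).div_const 2).add he
  have hmono : MonotoneOn (fun x : ℝ => x * (1 + exp (-x)) / 2 + exp (-x)) (Set.Ici 0) := by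
    refine monotoneOn_of_deriv_nonneg (convex_Ici 0)
      (fun x _ => (hd x).continuousAt.continuousWithinAt)
      (fun x _ => (hd x).differentiableAt.differentiableWithinAt) fun x _ => ?_
    rw [(hd x).deriv]
    have h1 : (x + 1) * exp (-x) ≤ 1 := by
      calc (x + 1) * exp (-x) ≤ exp x * exp (-x) := by
            gcongr; exact add_one_le_exp x
        _ = 1 := by rw [← exp_add]; simp
    linarith
  have := hmono Set.self_mem_Ici (Set.mem_Ici.mpr ht) ht
  simp only [neg_zero, exp_zero, zero_mul, zero_div, zero_add] at this
  linarith

/-- The centred Bernoulli law with parameter `α ≤ 1 / 2` has a lower tail that is sub-Gaussian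
with its own variance. -/
theorem bernoulli_mgf_neg_le {α t : ℝ} (hα0 : 0 < α) (hα : α ≤ 1 / 2) (ht : 0 ≤ t) :
    1 - α + α * exp (-t) ≤ exp (-(t * α) + t ^ 2 * (α * (1 - α)) / 2) := by
  have hpos : ∀ x : ℝ, 0 < 1 - α + α * exp (-x) := fun x => by
    have := mul_pos hα0 (exp_pos (-x))
    linarith
  have hd : ∀ x : ℝ, HasDerivAt
      (fun x : ℝ => -(x * α) + x ^ 2 * (α * (1 - α)) / 2 - log (1 - α + α * exp (-x)))
      (-(1 * α) + ((2 : ℕ) * x ^ (2 - 1)) * (α * (1 - α)) / 2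
        - (α * (exp (-x) * (-1))) / (1 - α + α * exp (-x))) x := by
    intro x
    have he : HasDerivAt (fun x : ℝ => exp (-x)) (exp (-x) * (-1)) x :=
      (hasDerivAt_neg x).exp
    exact ((((hasDerivAt_id' x).mul_const α).neg).add
      (((hasDerivAt_pow 2 x).mul_const _).div_const 2)).sub
        (((he.const_mul α).const_add (1 - α)).log (hpos x).ne')
  have hmono : MonotoneOn
      (fun x : ℝ => -(x * α) + x ^ 2 * (α * (1 - α)) / 2 - log (1 - α + α * exp (-x)))
      (Set.Ici 0) := by
    refine monotoneOn_of_deriv_nonneg (convex_Ici 0)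
      (fun x _ => (hd x).continuousAt.continuousWithinAt)
      (fun x _ => (hd x).differentiableAt.differentiableWithinAt) fun x hx => ?_
    rw [interior_Ici, Set.mem_Ioi] at hx
    rw [(hd x).deriv]
    have hD := hpos x
    have h1 := one_sub_exp_neg_le_half_mul hx.le
    have h2 : exp (-x) ≤ 1 := exp_le_one_iff.mpr (by linarith)
    have h3 : 1 - exp (-x) ≤ x * (1 - α + α * exp (-x)) := by
      nlinarith [mul_nonneg hx.le (mul_nonneg (sub_nonneg.mpr hα) (sub_nonneg.mpr h2))]
    have hv : 0 < α * (1 - α) := mul_pos hα0 (by linarith)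
    have key : -(1 * α) + ((2 : ℕ) * x ^ (2 - 1)) * (α * (1 - α)) / 2
        - (α * (exp (-x) * (-1))) / (1 - α + α * exp (-x))
        = α * (1 - α) * (x * (1 - α + α * exp (-x)) - (1 - exp (-x)))
          / (1 - α + α * exp (-x)) := by
      have := hD.ne'
      field_simp
      push_cast
      ring
    rw [key]
    exact div_nonneg (mul_nonneg hv.le (by linarith)) hD.le
  have h := hmono Set.self_mem_Ici (Set.mem_Ici.mpr ht) ht
  norm_num at h
  rw [← log_le_iff_le_exp (hpos t)]
  linarith

/-- Chernoff bound for the lower tail of a binomial law. -/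
theorem IsBinomial.measure_lt_le {Ω : Type*} [MeasurableSpace Ω] {Q : Measure Ω} {Y : Ω → ℕ}
    {M : ℕ} {p : ℝ} (hY : IsBinomial Q Y M p) (hp0 : 0 ≤ p) (hp1 : p ≤ 1) {t : ℝ} (ht : 0 ≤ t)
    (x : ℝ) :
    Q {ω | (Y ω : ℝ) < x} ≤ ENNReal.ofReal (exp (t * x) * (1 - p + p * exp (-t)) ^ M) := by
  have hq : 0 ≤ 1 - p := sub_nonneg.mpr hp1
  have hsub : {ω | (Y ω : ℝ) < x} ⊆
      ⋃ k ∈ (Finset.range (M + 1)).filter (fun k : ℕ => (k : ℝ) < x), {ω | Y ω = k} := by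
    intro ω hω
    simp only [Set.mem_iUnion, Finset.mem_filter, Finset.mem_range, Set.mem_ofPred_eq,
      exists_prop]
    exact ⟨Y ω, ⟨Nat.lt_succ_of_le (hY.2.1 ω), hω⟩, rfl⟩
  have hnn : ∀ k : ℕ, 0 ≤ (M.choose k : ℝ) * p ^ k * (1 - p) ^ (M - k) := fun k => by positivity
  refine (measure_mono hsub).trans ((measure_biUnion_finset_le _ _).trans ?_)
  simp only [hY.2.2]
  rw [← ENNReal.ofReal_sum_of_nonneg fun k _ => hnn k]
  refine ENNReal.ofReal_le_ofReal ?_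
  calc ∑ k ∈ (Finset.range (M + 1)).filter (fun k : ℕ => (k : ℝ) < x),
        (M.choose k : ℝ) * p ^ k * (1 - p) ^ (M - k)
      ≤ ∑ k ∈ (Finset.range (M + 1)).filter (fun k : ℕ => (k : ℝ) < x),
        exp (t * x) * exp (-t) ^ k * ((M.choose k : ℝ) * p ^ k * (1 - p) ^ (M - k)) := by
        refine Finset.sum_le_sum fun k hk => le_mul_of_one_le_left (hnn k) ?_
        have hkx := (Finset.mem_filter.mp hk).2
        rw [← exp_nat_mul, ← exp_add]
        refine one_le_exp ?_
        nlinarith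
    _ ≤ ∑ k ∈ Finset.range (M + 1),
        exp (t * x) * exp (-t) ^ k * ((M.choose k : ℝ) * p ^ k * (1 - p) ^ (M - k)) :=
        Finset.sum_le_sum_of_subset_of_nonneg (Finset.filter_subset _ _)
          fun k _ _ => mul_nonneg (by positivity) (hnn k)
    _ = exp (t * x) * (1 - p + p * exp (-t)) ^ M := by
        rw [add_comm (1 - p), add_pow, Finset.mul_sum]
        refine Finset.sum_congr rfl fun k _ => ?_
        rw [mul_pow]
        ring

/-- Okamoto's inequality for the lower tail, uniform over success probabilities `p ≥ α`. -/
theorem IsBinomial.measure_div_add_lt_le {Ω : Type*} [MeasurableSpace Ω] {Q : Measure Ω}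
    {Y : Ω → ℕ} {M : ℕ} {α p : ℝ} (hY : IsBinomial Q Y M p) (hM : 0 < M) (hα0 : 0 < α)
    (hα : α ≤ 1 / 2) (hpα : α ≤ p) (hp1 : p ≤ 1) {c : ℝ} (hc : 0 ≤ c) :
    Q {ω | (Y ω : ℝ) / M + √(α * (1 - α)) * c < α} ≤ ENNReal.ofReal (exp (-(M * c ^ 2 / 2))) := by
  have hv : 0 < α * (1 - α) := mul_pos hα0 (by linarith)
  have hs : 0 < √(α * (1 - α)) := sqrt_pos.mpr hv
  have hsq : √(α * (1 - α)) ^ 2 = α * (1 - α) := sq_sqrt hv.le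
  have hM' : (0 : ℝ) < M := by exact_mod_cast hM
  set s := √(α * (1 - α))
  have ht : 0 ≤ c / s := by positivity
  have hset : {ω | (Y ω : ℝ) / M + s * c < α} = {ω | (Y ω : ℝ) < (α - s * c) * M} := by
    ext ω
    simp only [Set.mem_ofPred_eq]
    rw [← div_lt_iff₀ hM', lt_sub_iff_add_lt]
  rw [hset]
  refine (hY.measure_lt_le (hα0.le.trans hpα) hp1 ht _).trans (ENNReal.ofReal_le_ofReal ?_)
  have h2 : exp (-(c / s)) ≤ 1 := exp_le_one_iff.mpr (by linarith)
  have hbase : 1 - p + p * exp (-(c / s))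
      ≤ exp (-(c / s * α) + (c / s) ^ 2 * (α * (1 - α)) / 2) := by
    refine le_trans ?_ (bernoulli_mgf_neg_le hα0 hα ht)
    nlinarith
  have hnn : 0 ≤ 1 - p + p * exp (-(c / s)) :=
    add_nonneg (by linarith) (mul_nonneg (by linarith) (exp_pos _).le)
  calc exp (c / s * ((α - s * c) * M)) * (1 - p + p * exp (-(c / s))) ^ M
      ≤ exp (c / s * ((α - s * c) * M))
        * exp (-(c / s * α) + (c / s) ^ 2 * (α * (1 - α)) / 2) ^ M := by gcongr
    _ = exp (-(M * c ^ 2 / 2)) := by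
        rw [← exp_nat_mul, ← exp_add, ← hsq]
        congr 1
        field_simp
        ring

/-- Corollary 6, first part (hybrid adaptive Borell–Monte-Carlo scheme): if the true
unsafety probability `p ≥ α` and the Borell-TIS bound `1 − Φ((1 − m̃)/σ̃) ≥ α`, then
the hybrid sequential test falsely declares safety with probability at most `ε`. -/
theorem hybrid_ABM_safe {Ω : Type*} [MeasurableSpace Ω] (Q : Measure Ω)
    [IsProbabilityMeasure Q] (α ε σtil mtil p : ℝ)
    (hα0 : 0 < α) (hα : α ≤ 1 / 2) (hε : ε ∈ Set.Ioo (0 : ℝ) 1)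
    (hσ : 0 < σtil) (hm : mtil ≤ 1)
    (hp0 : 0 ≤ p) (hp1 : p ≤ 1) (hpα : α ≤ p)
    (hP : α ≤ 1 - cdf (gaussianReal 0 1) ((1 - mtil) / σtil))
    (M : ℕ → ℕ) (hM : StrictMono M) (hMpos : ∀ r, 1 ≤ r → 0 < M r)
    (Y : ℕ → Ω → ℕ) (hY : ∀ r, 1 ≤ r → IsBinomial Q (Y r) (M r) p)
    (q : ℕ → Ω → ℝ) (hqmeas : ∀ r, Measurable (q r))
    (hq : ∀ r : ℕ, 1 ≤ r →
      Q {ω | q r ω < mtil} ≤ ENNReal.ofReal (3 * ε / (π ^ 2 * (r : ℝ) ^ 2)))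
    (c : ℕ → ℝ)
    (hc : ∀ r, c r = Real.sqrt ((2 / (M r : ℝ)) * |Real.log (3 * ε / (π ^ 2 * (r : ℝ) ^ 2))|)) :
    Q {ω | ∃ r : ℕ, 1 ≤ r ∧
        min (1 - cdf (gaussianReal 0 1) ((1 - q r ω) / σtil))
          ((Y r ω : ℝ) / (M r : ℝ) + Real.sqrt (α * (1 - α)) * c r) < α}
      ≤ ENNReal.ofReal ε := by
  have hε0 : 0 < ε := hε.1
  have hround : ∀ r : ℕ, Q {ω | 1 ≤ r ∧
      min (1 - cdf (gaussianReal 0 1) ((1 - q r ω) / σtil))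
        ((Y r ω : ℝ) / (M r : ℝ) + Real.sqrt (α * (1 - α)) * c r) < α}
      ≤ ENNReal.ofReal (6 * ε / π ^ 2 * (1 / (r : ℝ) ^ 2)) := by
    intro r
    rcases Nat.eq_zero_or_pos r with rfl | hr
    · simp
    have hr' : (1 : ℝ) ≤ r := by exact_mod_cast hr
    have hM' : (0 : ℝ) < M r := by exact_mod_cast hMpos r hr
    have hδ0 : 0 < 3 * ε / (π ^ 2 * (r : ℝ) ^ 2) := by positivity
    have hδ1 : 3 * ε / (π ^ 2 * (r : ℝ) ^ 2) ≤ 1 := by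
      rw [div_le_one (by positivity)]
      have hπ : 9 ≤ π ^ 2 := by nlinarith [pi_gt_three]
      have hr2 : 1 ≤ (r : ℝ) ^ 2 := one_le_pow₀ hr'
      nlinarith [hε.2]
    have hexp : exp (-(M r * c r ^ 2 / 2)) = 3 * ε / (π ^ 2 * (r : ℝ) ^ 2) := by
      rw [hc r, sq_sqrt (by positivity), abs_of_nonpos (log_nonpos hδ0.le hδ1)]
      conv_rhs => rw [← exp_log hδ0]
      congr 1
      field_simp
    have hMC := (hY r hr).measure_div_add_lt_le (hMpos r hr) hα0 hα hpα hp1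
      (c := c r) (by rw [hc r]; positivity)
    rw [hexp] at hMC
    have hsub : {ω | 1 ≤ r ∧
        min (1 - cdf (gaussianReal 0 1) ((1 - q r ω) / σtil))
          ((Y r ω : ℝ) / (M r : ℝ) + Real.sqrt (α * (1 - α)) * c r) < α} ⊆
        {ω | q r ω < mtil} ∪ {ω | (Y r ω : ℝ) / (M r : ℝ) + √(α * (1 - α)) * c r < α} := by
      rintro ω ⟨-, hω⟩
      refine (min_lt_iff.mp hω).imp (fun h => ?_) id
      have hlt := (monotone_cdf (gaussianReal 0 1)).reflect_lt
        (by linarith : cdf (gaussianReal 0 1) ((1 - mtil) / σtil)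
          < cdf (gaussianReal 0 1) ((1 - q r ω) / σtil))
      have := (div_lt_div_iff_of_pos_right hσ).mp hlt
      exact (by linarith : q r ω < mtil)
    refine (measure_mono hsub).trans ((measure_union_le _ _).trans
      ((add_le_add (hq r hr) hMC).trans_eq ?_))
    rw [← ENNReal.ofReal_add hδ0.le hδ0.le]
    congr 1
    field_simp
    norm_num
  have hsum := hasSum_zeta_two.mul_left (6 * ε / π ^ 2)
  rw [Set.ofPred_exists]
  calc _ ≤ _ := measure_iUnion_le _
    _ ≤ ∑' r : ℕ, ENNReal.ofReal (6 * ε / π ^ 2 * (1 / (r : ℝ) ^ 2)) :=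
        ENNReal.tsum_le_tsum hround
    _ = ENNReal.ofReal ε := by
        rw [← ENNReal.ofReal_tsum_of_nonneg (fun r => by positivity) hsum.summable,
          hsum.tsum_eq]
        congr 1
        field_simp
end
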